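/- arXiv:2301.03906 — 5 statements merged into one kernel-verified Lean document; each statement's English description precedes it below -/
import Mathlib

section
/- For every tuple (y₁, y₂, y₃, y₄, y₅, y₆, y₇, y₈) of complex numbers there exist A, B, C in SL(3,ℂ) with CBA = I such that tr(A) = y₁, tr(B) = y₂, tr(C) = y₃, σ₊(A,B,C) = y₄, tr(A⁻¹) = y₅, tr(B⁻¹) = y₆, tr(C⁻¹) = y₇ and σ₋(A,B,C) = y₈. -/
open Matrix

/-- There are `A`, `B` in `SL(3, ℂ)` such that `A`, `A⁻¹` have traces `p`, `p'`, such that `B`, `B⁻¹`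
have traces `q`, `q'`, and such that `B * A`, `A⁻¹ * B`, `B⁻¹ * A`, `A⁻¹ * B⁻¹` have traces
`t₁`, `t₂`, `t₃`, `t₄`. The inverses are witnessed by the matrices `A'` and `B'`. -/
def HasPairTraces (p p' q q' t₁ t₂ t₃ t₄ : ℂ) : Prop :=
  ∃ A A' B B' : Matrix (Fin 3) (Fin 3) ℂ,
    A.det = 1 ∧ B.det = 1 ∧ A * A' = 1 ∧ B * B' = 1 ∧
    A.trace = p ∧ A'.trace = p' ∧ B.trace = q ∧ B'.trace = q' ∧
    (B * A).trace = t₁ ∧ (A' * B).trace = t₂ ∧ (B' * A).trace = t₃ ∧ (A' * B').trace = t₄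

/-- For a pair `A`, `B` with the traces of `HasPairTraces` and eigenvalues `a` of `A` and `b` of `B`,
this is the trace of `(A⁻¹ + a A - a (p - a)) * (B⁻¹ + b B - b (q - b))`, a product of two matrices
of rank at most one with images in the respective eigenspaces. -/
def eigenPairing (p p' q q' t₁ t₂ t₃ t₄ a b : ℂ) : ℂ :=
  t₄ + b * t₂ + a * t₃ + a * b * t₁ - b * (q - b) * (p' + a * p) - a * (p - a) * (q' + b * q)
    + 3 * (a * (p - a)) * (b * (q - b))

theorem exists_quadratic_root (a b c : ℂ) (ha : a ≠ 0) : ∃ x : ℂ, a * x ^ 2 + b * x + c = 0 := by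
  obtain ⟨s, hs⟩ := IsAlgClosed.exists_eq_mul_self (discrim a b c)
  obtain ⟨x, hx⟩ := exists_quadratic_eq_zero ha ⟨s, hs⟩
  exact ⟨x, by linear_combination hx⟩

theorem exists_roots_of_unimodular_cubic (p p' : ℂ) :
    ∃ a b c : ℂ, a + b + c = p ∧ a * b + a * c + b * c = p' ∧ a * b * c = 1 := by
  open Polynomial in
  have hdeg : (X ^ 3 - C p * X ^ 2 + C p' * X - 1 : ℂ[X]).degree = 3 := by
    compute_degree!
  obtain ⟨a, ha⟩ := IsAlgClosed.exists_root _ (by rw [hdeg]; norm_num)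
  simp only [Polynomial.IsRoot, Polynomial.eval_sub, Polynomial.eval_add, Polynomial.eval_mul,
    Polynomial.eval_pow, Polynomial.eval_X, Polynomial.eval_C, Polynomial.eval_one] at ha
  have ha0 : a ≠ 0 := by
    rintro rfl
    norm_num at ha
  obtain ⟨b, hb⟩ := exists_quadratic_root 1 (-(p - a)) (p' - a * (p - a)) one_ne_zero
  exact ⟨a, b, p - a - b, by ring, by linear_combination -hb,
    by linear_combination ha - a * hb⟩

/-- Upper and lower triangular matrices with prescribed diagonals and prescribed torus-invariant
products of the off-diagonal entries. -/
theorem exists_offdiagonal_entries {X Y Z V W : ℂ} (h : V * W = X * Y * Z) :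
    ∃ p q r s t u : ℂ,
      p * s = X ∧ q * t = Y ∧ r * u = Z ∧ p * q * u = V ∧ r * s * t = W := by
  by_cases hV : V = 0
  · by_cases hW : W = 0
    · subst hV hW
      have h0 : X * Y * Z = 0 := by rw [← h, zero_mul]
      rcases mul_eq_zero.mp h0 with h1 | rfl
      · rcases mul_eq_zero.mp h1 with rfl | rfl
        · exact ⟨0, 1, 1, 0, Y, Z, by simp⟩
        · exact ⟨1, 0, 1, X, 0, Z, by simp⟩
      · exact ⟨1, 1, 0, X, Y, 0, by simp⟩
    · refine ⟨X, Y, W, 1, 1, Z / W, ?_, ?_, ?_, ?_, ?_⟩ <;> field_simp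
      linear_combination -h
  · refine ⟨1, 1, Z / V, X, Y, V, ?_, ?_, ?_, ?_, ?_⟩ <;> field_simp
    linear_combination -h

section

variable {a₁ a₂ a₃ b₁ b₂ b₃ : ℂ}

theorem hasPairTraces_of_triangular (ha : a₁ * a₂ * a₃ = 1) (hb : b₁ * b₂ * b₃ = 1)
    {X Y Z V W : ℂ} (h : V * W = X * Y * Z) :
    HasPairTraces (a₁ + a₂ + a₃) (a₁ * a₂ + a₁ * a₃ + a₂ * a₃)
      (b₁ + b₂ + b₃) (b₁ * b₂ + b₁ * b₃ + b₂ * b₃)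
      (a₁ * b₁ + a₂ * b₂ + a₃ * b₃ + X + Y + Z)
      (a₂ * a₃ * b₁ + a₁ * a₃ * b₂ + a₁ * a₂ * b₃ - a₃ * X - a₁ * Y - a₂ * Z + V)
      (b₂ * b₃ * a₁ + b₁ * b₃ * a₂ + b₁ * b₂ * a₃ - b₃ * X - b₁ * Y - b₂ * Z + W)
      (a₂ * a₃ * b₂ * b₃ + a₁ * a₃ * b₁ * b₃ + a₁ * a₂ * b₁ * b₂
        + a₃ * b₃ * X + a₁ * b₁ * Y + a₂ * b₂ * Z + X * Y - b₂ * V - a₂ * W) := by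
  obtain ⟨p, q, r, s, t, u, rfl, rfl, rfl, rfl, rfl⟩ := exists_offdiagonal_entries h
  refine ⟨!![a₁, p, r; 0, a₂, q; 0, 0, a₃],
    !![a₂ * a₃, -p * a₃, p * q - r * a₂; 0, a₁ * a₃, -q * a₁; 0, 0, a₁ * a₂],
    !![b₁, 0, 0; s, b₂, 0; u, t, b₃],
    !![b₂ * b₃, 0, 0; -s * b₃, b₁ * b₃, 0; s * t - u * b₂, -t * b₁, b₁ * b₂],
    ?_, ?_, ?_, ?_, ?_, ?_, ?_, ?_, ?_, ?_, ?_, ?_⟩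
  · simp [det_fin_three, ha]
  · simp [det_fin_three, hb]
  · ext i j
    fin_cases i <;> fin_cases j <;> simp [mul_apply, Fin.sum_univ_three] <;> grind
  · ext i j
    fin_cases i <;> fin_cases j <;> simp [mul_apply, Fin.sum_univ_three] <;> grind
  all_goals simp [trace_fin_three]; try ring

/-- If some eigenvalues pair to zero, there is a solution whose invariant flags are not transverse. -/
theorem hasPairTraces_of_eigenPairing_eq_zero (ha : a₁ * a₂ * a₃ = 1) (hb : b₁ * b₂ * b₃ = 1)
    (t₁ t₂ t₃ t₄ : ℂ)
    (h : eigenPairing (a₁ + a₂ + a₃) (a₁ * a₂ + a₁ * a₃ + a₂ * a₃)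
      (b₁ + b₂ + b₃) (b₁ * b₂ + b₁ * b₃ + b₂ * b₃) t₁ t₂ t₃ t₄ a₁ b₁ = 0) :
    HasPairTraces (a₁ + a₂ + a₃) (a₁ * a₂ + a₁ * a₃ + a₂ * a₃)
      (b₁ + b₂ + b₃) (b₁ * b₂ + b₁ * b₃ + b₂ * b₃) t₁ t₂ t₃ t₄ := by
  obtain ⟨Z, hZ⟩ : ∃ Z, Z = t₁ - (a₁ * b₂ + a₂ * b₁ + a₃ * b₃) := ⟨_, rfl⟩
  obtain ⟨V, hV⟩ : ∃ V, V = t₂ - (a₂ * a₃ * b₂ + a₁ * a₃ * b₁ + a₁ * a₂ * b₃) + a₂ * Z := ⟨_, rfl⟩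
  obtain ⟨W, hW⟩ : ∃ W, W = t₃ - (b₁ * b₃ * a₁ + b₂ * b₃ * a₂ + b₁ * b₂ * a₃) + b₁ * Z := ⟨_, rfl⟩
  refine ⟨!![a₁, V, Z; 0, a₂, 1; 0, 0, a₃],
    !![a₂ * a₃, -V * a₃, V - Z * a₂; 0, a₁ * a₃, -a₁; 0, 0, a₁ * a₂],
    !![b₂, W, 0; 0, b₁, 0; 1, 0, b₃],
    !![b₁ * b₃, -W * b₃, 0; 0, b₂ * b₃, 0; -b₁, W, b₁ * b₂],
    ?_, ?_, ?_, ?_, ?_, ?_, ?_, ?_, ?_, ?_, ?_, ?_⟩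
  · simp [det_fin_three, ha]
  · simp [det_fin_three]
    linear_combination hb
  · ext i j
    fin_cases i <;> fin_cases j <;> simp [mul_apply, Fin.sum_univ_three] <;> grind
  · ext i j
    fin_cases i <;> fin_cases j <;> simp [mul_apply, Fin.sum_univ_three] <;> grind
  all_goals simp [trace_fin_three]
  · ring
  · ring
  · ring
  · linear_combination hZ
  · linear_combination hV
  · linear_combination hW
  · simp only [eigenPairing] at h
    linear_combination -h - b₁ * hV - a₁ * hW - a₁ * b₁ * hZ

theorem hasPairTraces_of_eigenPairing_ne_zero (ha : a₁ * a₂ * a₃ = 1) (hb : b₁ * b₂ * b₃ = 1)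
    {p p' q q' t₁ t₂ t₃ t₄ : ℂ}
    (hp : a₁ + a₂ + a₃ = p) (hp' : a₁ * a₂ + a₁ * a₃ + a₂ * a₃ = p')
    (hq : b₁ + b₂ + b₃ = q) (hq' : b₁ * b₂ + b₁ * b₃ + b₂ * b₃ = q')
    (h₁ : eigenPairing p p' q q' t₁ t₂ t₃ t₄ a₁ b₁ ≠ 0)
    (h₂ : eigenPairing p p' q q' t₁ t₂ t₃ t₄ a₂ b₂ ≠ 0)
    (h₃ : eigenPairing p p' q q' t₁ t₂ t₃ t₄ a₃ b₃ ≠ 0) :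
    HasPairTraces p p' q q' t₁ t₂ t₃ t₄ := by
  obtain ⟨f₁, hf₁⟩ : ∃ f, f = eigenPairing p p' q q' t₁ t₂ t₃ t₄ a₁ b₁ := ⟨_, rfl⟩
  obtain ⟨f₂, hf₂⟩ : ∃ f, f = eigenPairing p p' q q' t₁ t₂ t₃ t₄ a₂ b₂ := ⟨_, rfl⟩
  obtain ⟨f₃, hf₃⟩ : ∃ f, f = eigenPairing p p' q q' t₁ t₂ t₃ t₄ a₃ b₃ := ⟨_, rfl⟩
  rw [← hf₁] at h₁
  rw [← hf₂] at h₂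
  rw [← hf₃] at h₃
  obtain ⟨k₁, hk₁⟩ : ∃ k, k = t₁ - (a₁ * b₁ + a₂ * b₂ + a₃ * b₃) := ⟨_, rfl⟩
  obtain ⟨k₂, hk₂⟩ : ∃ k, k = t₂ - (a₂ * a₃ * b₁ + a₁ * a₃ * b₂ + a₁ * a₂ * b₃) := ⟨_, rfl⟩
  obtain ⟨k₃, hk₃⟩ : ∃ k, k = t₃ - (b₂ * b₃ * a₁ + b₁ * b₃ * a₂ + b₁ * b₂ * a₃) := ⟨_, rfl⟩
  obtain ⟨k₄, hk₄⟩ : ∃ k, k = t₄ -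
    (a₂ * a₃ * b₂ * b₃ + a₁ * a₃ * b₁ * b₃ + a₁ * a₂ * b₁ * b₂) := ⟨_, rfl⟩
  have e₁ : f₁ = k₄ + b₁ * k₂ + a₁ * k₃ + a₁ * b₁ * k₁
      + (a₁ - a₂) * (a₁ - a₃) * (b₁ - b₂) * (b₁ - b₃) := by
    rw [hf₁, hk₁, hk₂, hk₃, hk₄, eigenPairing, ← hp, ← hp', ← hq, ← hq']
    ring
  have e₂ : f₂ = k₄ + b₂ * k₂ + a₂ * k₃ + a₂ * b₂ * k₁
      + (a₂ - a₁) * (a₂ - a₃) * (b₂ - b₁) * (b₂ - b₃) := by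
    rw [hf₂, hk₁, hk₂, hk₃, hk₄, eigenPairing, ← hp, ← hp', ← hq, ← hq']
    ring
  have e₃ : f₃ = k₄ + b₃ * k₂ + a₃ * k₃ + a₃ * b₃ * k₁
      + (a₃ - a₁) * (a₃ - a₂) * (b₃ - b₁) * (b₃ - b₂) := by
    rw [hf₃, hk₁, hk₂, hk₃, hk₄, eigenPairing, ← hp, ← hp', ← hq, ← hq']
    ring
  obtain ⟨m, hm⟩ : ∃ m, m = a₃ - a₂ := ⟨_, rfl⟩
  obtain ⟨n, hn⟩ : ∃ n, n = a₁ - a₂ := ⟨_, rfl⟩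
  obtain ⟨m', hm'⟩ : ∃ m', m' = b₃ - b₂ := ⟨_, rfl⟩
  obtain ⟨n', hn'⟩ : ∃ n', n' = b₁ - b₂ := ⟨_, rfl⟩
  obtain ⟨v, hv⟩ : ∃ v, v = k₂ + a₂ * k₁ - m * (n * n') - n * (m * m') := ⟨_, rfl⟩
  obtain ⟨w, hw⟩ : ∃ w, w = k₃ + b₂ * k₁ - m' * (n * n') - n' * (m * m') := ⟨_, rfl⟩
  obtain ⟨c, hc⟩ : ∃ c, c = k₁ + m * m' + n * n' := ⟨_, rfl⟩
  obtain ⟨d, hd⟩ : ∃ d, d = (m * m' + n * n') * f₂ + c * (f₂ + m * m' * (n * n')) - v * w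
    - f₂ * (m * n' + n * m') := ⟨_, rfl⟩
  have g₃ : f₃ = m * m' * c + f₂ + m * m' * (n * n') + m * w + m' * v := by
    rw [e₃, e₂, hv, hw, hc, hm, hn, hm', hn']
    ring
  have g₁ : f₁ = n * n' * c + f₂ + m * m' * (n * n') + n * w + n' * v := by
    rw [e₁, e₂, hv, hw, hc, hm, hn, hm', hn']
    ring
  obtain ⟨x, hx⟩ := exists_quadratic_root f₃ (-d) (f₁ * f₂) h₃
  have hx0 : x ≠ 0 := by
    rintro rfl
    exact mul_ne_zero h₁ h₂ (by linear_combination hx)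
  obtain ⟨z, hz⟩ : ∃ z, x * z = f₂ := ⟨f₂ / x, mul_div_cancel₀ _ hx0⟩
  have hxz : f₃ * x - d + f₁ * z = 0 := by
    apply mul_left_cancel₀ hx0
    linear_combination hx + f₁ * hz
  have hrel : (v + m * x + n * z) * (w + m' * x + n' * z)
      = (x - n * n') * (z - m * m') * (c - x - z) := by
    rw [g₃, g₁, hd, ← hz] at hxz
    linear_combination hxz
  have key := hasPairTraces_of_triangular ha hb hrel
  rw [hp, hp', hq, hq'] at key
  convert key using 1
  · linear_combination -hk₁ - hc
  · rw [hv, hc, hm, hn]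
    linear_combination -hk₂
  · rw [hw, hc, hm', hn']
    linear_combination -hk₃
  · rw [hv, hw, hc]
    rw [e₂] at hz
    rw [hm, hn, hm', hn']
    linear_combination -hk₄ - hz

end

theorem hasPairTraces (p p' q q' t₁ t₂ t₃ t₄ : ℂ) : HasPairTraces p p' q q' t₁ t₂ t₃ t₄ := by
  obtain ⟨a₁, a₂, a₃, hp, hp', ha⟩ := exists_roots_of_unimodular_cubic p p'
  obtain ⟨b₁, b₂, b₃, hq, hq', hb⟩ := exists_roots_of_unimodular_cubic q q'
  by_cases h₁ : eigenPairing p p' q q' t₁ t₂ t₃ t₄ a₁ b₁ = 0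
  · subst hp hp' hq hq'
    exact hasPairTraces_of_eigenPairing_eq_zero ha hb t₁ t₂ t₃ t₄ h₁
  by_cases h₂ : eigenPairing p p' q q' t₁ t₂ t₃ t₄ a₂ b₂ = 0
  · rw [show p = a₂ + a₁ + a₃ by rw [← hp]; ring,
      show p' = a₂ * a₁ + a₂ * a₃ + a₁ * a₃ by rw [← hp']; ring,
      show q = b₂ + b₁ + b₃ by rw [← hq]; ring,
      show q' = b₂ * b₁ + b₂ * b₃ + b₁ * b₃ by rw [← hq']; ring] at h₂ ⊢
    exact hasPairTraces_of_eigenPairing_eq_zero (by linear_combination ha)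
      (by linear_combination hb) t₁ t₂ t₃ t₄ h₂
  by_cases h₃ : eigenPairing p p' q q' t₁ t₂ t₃ t₄ a₃ b₃ = 0
  · rw [show p = a₃ + a₁ + a₂ by rw [← hp]; ring,
      show p' = a₃ * a₁ + a₃ * a₂ + a₁ * a₂ by rw [← hp']; ring,
      show q = b₃ + b₁ + b₂ by rw [← hq]; ring,
      show q' = b₃ * b₁ + b₃ * b₂ + b₁ * b₂ by rw [← hq']; ring] at h₃ ⊢
    exact hasPairTraces_of_eigenPairing_eq_zero (by linear_combination ha)
      (by linear_combination hb) t₁ t₂ t₃ t₄ h₃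
  exact hasPairTraces_of_eigenPairing_ne_zero ha hb hp hp' hq hq' h₁ h₂ h₃

theorem exists_triple_with_prescribed_traces_and_shape_invariants
    (y₁ y₂ y₃ y₄ y₅ y₆ y₇ y₈ : ℂ) :
    ∃ A B C : Matrix (Fin 3) (Fin 3) ℂ,
      A.det = 1 ∧ B.det = 1 ∧ C.det = 1 ∧ C * B * A = 1 ∧
      A.trace = y₁ ∧ B.trace = y₂ ∧ C.trace = y₃ ∧
      (A⁻¹ * B).trace - (A⁻¹).trace * B.trace = y₄ ∧
      (A⁻¹).trace = y₅ ∧ (B⁻¹).trace = y₆ ∧ (C⁻¹).trace = y₇ ∧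
      (B⁻¹ * A).trace - (B⁻¹).trace * A.trace = y₈ := by
  obtain ⟨A, A', B, B', hA, hB, hAA', hBB', h₁, h₅, h₂, h₆, h₇, h₄, h₈, h₃⟩ :=
    hasPairTraces y₁ y₅ y₂ y₆ y₇ (y₄ + y₅ * y₂) (y₈ + y₆ * y₁) y₃
  have hA'A : A' * A = 1 := mul_eq_one_comm.mp hAA'
  have hB'B : B' * B = 1 := mul_eq_one_comm.mp hBB'
  have hdA' : A'.det = 1 := by simpa [hA] using congrArg det hAA'
  have hdB' : B'.det = 1 := by simpa [hB] using congrArg det hBB'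
  have hC : A' * B' * (B * A) = 1 := by
    rw [Matrix.mul_assoc, ← Matrix.mul_assoc B', hB'B, Matrix.one_mul, hA'A]
  refine ⟨A, B, A' * B', hA, hB, by rw [det_mul, hdA', hdB', one_mul],
    by rw [Matrix.mul_assoc, hC], h₁, h₂, h₃, ?_⟩
  rw [inv_eq_right_inv hAA', inv_eq_right_inv hBB', inv_eq_right_inv hC, h₄, h₅, h₆, h₇, h₈, h₁, h₂]
  exact ⟨by ring, rfl, rfl, rfl, by ring⟩
end

section
/- Let A, B be in SL(3,ℂ) such that the pair {A, B} is irreducible, and let A', B' be in SL(3,ℂ). Suppose that tr(A) = tr(A'), tr(B) = tr(B'), tr(AB) = tr(A'B'), tr(A⁻¹B) = tr(A'⁻¹B'), tr(A⁻¹) = tr(A'⁻¹), tr(B⁻¹) = tr(B'⁻¹), tr(B⁻¹A⁻¹) = tr(B'⁻¹A'⁻¹), tr(B⁻¹A) = tr(B'⁻¹A') and tr(ABA⁻¹B⁻¹) = tr(A'B'A'⁻¹B'⁻¹). Then there exists D in SL(3,ℂ) with A' = DAD⁻¹ and B' = DBD⁻¹. -/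
open Matrix

/-- A pair of matrices acting on `ℂ³` is irreducible if the only invariant
subspaces are `⊥` and `⊤`. -/
def IsIrreduciblePair (A B : Matrix (Fin 3) (Fin 3) ℂ) : Prop :=
  ∀ W : Submodule ℂ (Fin 3 → ℂ),
    (∀ v ∈ W, A.mulVec v ∈ W) → (∀ v ∈ W, B.mulVec v ∈ W) → W = ⊥ ∨ W = ⊤

/-- **Burnside's theorem** on matrix algebras: over an algebraically closed field, a subalgebra of
`End V` acting irreducibly on a finite-dimensional space `V` is everything. -/
theorem Subalgebra.eq_top_of_isSimpleModule {k V : Type*} [Field k] [IsAlgClosed k]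
    [AddCommGroup V] [Module k V] [FiniteDimensional k V] (S : Subalgebra k (Module.End k V))
    [IsSimpleModule S V] : S = ⊤ := by
  refine eq_top_iff.2 fun f _ ↦ ?_
  have scalar := (IsSimpleModule.algebraMap_end_bijective_of_isAlgClosed (A := S) (V := V) k).2
  let F : Module.End (Module.End S V) V :=
    { f with
      map_smul' := fun g v ↦ by
        obtain ⟨c, rfl⟩ := scalar g
        simp }
  obtain ⟨s, hs⟩ := Module.Finite.fg_top (R := k) (M := V)
  obtain ⟨r, hr⟩ := jacobson_density F s
  have : f = r := LinearMap.ext_on hs fun v hv ↦ hr v hv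
  exact this ▸ r.2

namespace Matrix

/-- Two matrix representations of an algebra with the same character are conjugate as soon as one
of them is surjective. -/
theorem exists_conj_of_trace_eq {k R n : Type*} [Field k] [Ring R] [Algebra k R] [Fintype n]
    [DecidableEq n] {φ ψ : R →ₐ[k] Matrix n n k} (hφ : Function.Surjective φ)
    (h : ∀ r, (φ r).trace = (ψ r).trace) :
    ∃ P : Matrix n n k, IsUnit P.det ∧ ∀ r, ψ r = P * φ r * P⁻¹ := by
  have ker_le (f g : R →ₐ[k] Matrix n n k) (hf : Function.Surjective f)
      (hfg : ∀ r, (f r).trace = (g r).trace) (r : R) (hr : g r = 0) : f r = 0 := by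
    refine ext_iff_trace_mul_left.2 fun x ↦ ?_
    obtain ⟨s, rfl⟩ := hf x
    rw [← map_mul, hfg, map_mul, hr]
    simp
  obtain ⟨s, hs⟩ := φ.toLinearMap.exists_rightInverse_of_surjective (LinearMap.range_eq_top.2 hφ)
  replace hs (x) : φ (s x) = x := congr($hs x)
  have hinj : Function.Injective (ψ.toLinearMap ∘ₗ s) := by
    refine (injective_iff_map_eq_zero _).2 fun x hx ↦ ?_
    rw [← hs x]
    exact ker_le φ ψ hφ h _ hx
  have hsurj := LinearMap.injective_iff_surjective.1 hinj
  have hψ : Function.Surjective ψ := fun y ↦ (hsurj y).imp' s fun _ hx ↦ hx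
  have key {r t : R} (hrt : φ r = φ t) : ψ r = ψ t := by
    rw [← sub_eq_zero, ← map_sub]
    exact ker_le ψ φ hψ (fun r ↦ (h r).symm) _ (by rw [map_sub, hrt, sub_self])
  let e : Matrix n n k ≃ₐ[k] Matrix n n k := AlgEquiv.ofBijective
    (AlgHom.ofLinearMap (ψ.toLinearMap ∘ₗ s)
      ((key (by rw [hs, map_one])).trans (map_one ψ))
      fun x y ↦ (key (by rw [hs, map_mul, hs, hs])).trans (map_mul ψ _ _))
    ⟨hinj, hsurj⟩
  have he (r : R) : e (φ r) = ψ r := key (hs _)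
  obtain ⟨T, hT⟩ := ((toLinAlgEquiv'.symm.trans e).trans toLinAlgEquiv').eq_linearEquivConjAlgEquiv
  have hP : LinearMap.toMatrix' T.toLinearMap * LinearMap.toMatrix' T.symm.toLinearMap = 1 := by
    rw [← LinearMap.toMatrix'_comp]
    simp
  refine ⟨LinearMap.toMatrix' T.toLinearMap, isUnit_det_of_right_inverse hP, fun r ↦ ?_⟩
  have := congr(LinearMap.toMatrix' ($hT (toLinAlgEquiv' (φ r))))
  rw [inv_eq_right_inv hP, ← he]
  have hl (M : Matrix n n k) : LinearMap.toMatrix' (toLinAlgEquiv' M) = M :=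
    LinearMap.toMatrix'_toLin' M
  simpa [LinearEquiv.conjAlgEquiv_apply, LinearMap.toMatrix'_comp, hl, mul_assoc] using this

end Matrix

namespace Matrix

section WordTrace

variable {n R L : Type*} [Fintype n] [DecidableEq n] [CommRing R]

/-- The trace of the product of the matrices `ρ l` along a word `w` in the letters `l`. -/
def wordTrace (ρ : L → Matrix n n R) (w : List L) : R :=
  ((w.map ρ).prod).trace

theorem wordTrace_append_comm (ρ : L → Matrix n n R) (u v : List L) :
    wordTrace ρ (u ++ v) = wordTrace ρ (v ++ u) := by
  simp only [wordTrace, List.map_append, List.prod_append]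
  exact trace_mul_comm _ _

theorem wordTrace_eq_of_isRotated (ρ : L → Matrix n n R) {u v : List L} (h : u ~r v) :
    wordTrace ρ u = wordTrace ρ v := by
  obtain ⟨k, hk, rfl⟩ := List.isRotated_iff_mod.1 h
  rw [List.rotate_eq_drop_append_take hk, wordTrace_append_comm, List.take_append_drop]

theorem wordTrace_cons_cons_of_mul_eq_one (ρ : L → Matrix n n R) {x y : L} (h : ρ x * ρ y = 1)
    (w : List L) : wordTrace ρ (x :: y :: w) = wordTrace ρ w := by
  simp [wordTrace, ← mul_assoc, h]

/-- The polarized Cayley-Hamilton identity for `3 × 3` matrices. -/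
theorem mul_mul_self_fin_three (U V : Matrix (Fin 3) (Fin 3) R) :
    U * V * U = -(U.adjugate * V) - V * U.adjugate + U.adjugate.trace • V
      + V.trace • U.adjugate - (U.adjugate.trace * V.trace) • (1 : Matrix (Fin 3) (Fin 3) R)
      + (U * V).trace • U + (U.adjugate * V).trace • (1 : Matrix (Fin 3) (Fin 3) R) := by
  ext i j
  fin_cases i <;> fin_cases j <;>
    simp [adjugate_fin_three, mul_apply, trace_fin_three, Fin.sum_univ_three, vecMul,
      dotProduct] <;> ring

theorem wordTrace_repeated (ρ : L → Matrix (Fin 3) (Fin 3) R) {x y : L}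
    (h : ρ y = (ρ x).adjugate) (v w : List L) :
    wordTrace ρ (x :: v ++ x :: w) =
      -wordTrace ρ (y :: v ++ w) - wordTrace ρ (v ++ y :: w)
        + wordTrace ρ [y] * wordTrace ρ (v ++ w) + wordTrace ρ v * wordTrace ρ (y :: w)
        - wordTrace ρ [y] * wordTrace ρ v * wordTrace ρ w
        + wordTrace ρ (x :: v) * wordTrace ρ (x :: w)
        + wordTrace ρ (y :: v) * wordTrace ρ w := by
  simp only [wordTrace, List.map_append, List.map_cons, List.prod_append, List.prod_cons,
    List.map_nil, List.prod_nil, mul_one, h]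
  generalize (w.map ρ).prod = W
  generalize (v.map ρ).prod = V
  rw [← mul_assoc, mul_mul_self_fin_three]
  simp only [add_mul, sub_mul, neg_mul, smul_mul_assoc, one_mul, trace_add, trace_sub, trace_neg,
    trace_smul, smul_eq_mul, mul_assoc]

end WordTrace

section TwoGenerators

variable {R : Type*} [CommRing R]

/-- The letter `(i, s)` inverse to a letter, where `i` names a generator and `s` its sign. -/
def invLetter (l : Bool × Bool) : Bool × Bool := (l.1, !l.2)

theorem invLetter_invLetter (l : Bool × Bool) : invLetter (invLetter l) = l := by
  simp [invLetter]

theorem exists_adjacent_invLetter_of_nodup_three : ∀ a b c : Bool × Bool, [a, b, c].Nodup →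
    b = invLetter a ∨ c = invLetter b ∨ a = invLetter c := by
  decide

theorem exists_adjacent_invLetter_of_nodup_four : ∀ a b c d : Bool × Bool, [a, b, c, d].Nodup →
    b = invLetter a ∨ c = invLetter b ∨ d = invLetter c ∨ a = invLetter d ∨
      [a, b, c, d] ~r [(true, true), (false, true), (true, false), (false, false)] ∨
      [a, b, c, d] ~r [(true, false), (false, true), (true, true), (false, false)] := by
  decide

theorem _root_.List.exists_eq_append_cons_append_cons_of_not_nodup {α : Type*} {l : List α}
    (h : ¬ l.Nodup) : ∃ (x : α) (u v w : List α), l = u ++ (x :: v ++ x :: w) := by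
  induction l with
  | nil => simp at h
  | cons a l ih =>
    by_cases ha : a ∈ l
    · obtain ⟨v, w, rfl⟩ := List.append_of_mem ha
      exact ⟨a, [], v, w, rfl⟩
    · obtain ⟨x, u, v, w, rfl⟩ := ih (by simpa [ha] using h)
      exact ⟨x, a :: u, v, w, rfl⟩

variable {ρ σ : Bool × Bool → Matrix (Fin 3) (Fin 3) R}

theorem wordTrace_eq_of_not_nodup (hρ : ∀ l, ρ (invLetter l) = (ρ l).adjugate)
    (hσ : ∀ l, σ (invLetter l) = (σ l).adjugate) {w : List (Bool × Bool)} (hw : ¬ w.Nodup)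
    (ih : ∀ v : List (Bool × Bool), v.length < w.length → wordTrace ρ v = wordTrace σ v) :
    wordTrace ρ w = wordTrace σ w := by
  obtain ⟨x, u, v, w, rfl⟩ := List.exists_eq_append_cons_append_cons_of_not_nodup hw
  simp only [List.length_append, List.length_cons] at ih
  rw [wordTrace_append_comm ρ, wordTrace_append_comm σ, List.append_assoc, List.cons_append (as := w),
    wordTrace_repeated ρ (hρ x), wordTrace_repeated σ (hσ x)]
  rw [ih (invLetter x :: v ++ (w ++ u)), ih (v ++ invLetter x :: (w ++ u)), ih [invLetter x],
    ih (v ++ (w ++ u)), ih v, ih (invLetter x :: (w ++ u)), ih (w ++ u), ih (x :: v),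
    ih (x :: (w ++ u)), ih (invLetter x :: v)] <;> grind

/-- The traces of the commutators of `x` with `y` and of `x⁻¹` with `y` determine each other
modulo the traces of shorter words. -/
theorem wordTrace_commutator_eq (hρ : ∀ l, ρ (invLetter l) = (ρ l).adjugate)
    (hσ : ∀ l, σ (invLetter l) = (σ l).adjugate)
    (hρ' : ∀ l, ρ l * ρ (invLetter l) = 1) (hσ' : ∀ l, σ l * σ (invLetter l) = 1)
    (ih : ∀ v : List (Bool × Bool), v.length < 4 → wordTrace ρ v = wordTrace σ v)
    {x y : Bool × Bool}
    (h : wordTrace ρ [x, y, invLetter x, invLetter y] =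
      wordTrace σ [x, y, invLetter x, invLetter y]) :
    wordTrace ρ [invLetter x, y, x, invLetter y] =
      wordTrace σ [invLetter x, y, x, invLetter y] := by
  have expand (τ : Bool × Bool → Matrix (Fin 3) (Fin 3) R)
      (hτ : ∀ l, τ (invLetter l) = (τ l).adjugate) (hτ' : ∀ l, τ l * τ (invLetter l) = 1) := by
    have e₁ := wordTrace_repeated τ (hτ x) [y] [x, invLetter y]
    have e₂ := wordTrace_repeated τ (hτ x) [] [invLetter y, x, y]
    have r₁ : wordTrace τ [x, y, x, x, invLetter y] = wordTrace τ [x, x, invLetter y, x, y] :=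
      wordTrace_append_comm τ [x, y] [x, x, invLetter y]
    have r₂ : wordTrace τ [invLetter x, invLetter y, x, y] =
        wordTrace τ [x, y, invLetter x, invLetter y] :=
      wordTrace_append_comm τ [invLetter x, invLetter y] [x, y]
    have r₃ : wordTrace τ [y, invLetter x, x, invLetter y] = 3 := by
      have hx := hτ' (invLetter x)
      rw [invLetter_invLetter] at hx
      rw [wordTrace_eq_of_isRotated τ (v := [invLetter x, x, invLetter y, y]) ⟨1, rfl⟩,
        wordTrace_cons_cons_of_mul_eq_one τ hx, wordTrace_eq_of_isRotated τ
          (v := [y, invLetter y]) ⟨1, rfl⟩, wordTrace_cons_cons_of_mul_eq_one τ (hτ' y)]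
      simp [wordTrace]
    have r₄ : wordTrace τ [] = 3 := by simp [wordTrace]
    simp only [List.cons_append, List.nil_append, r₁, r₂, r₃, r₄] at e₁ e₂
    exact e₁.symm.trans e₂
  have eρ := expand ρ hρ hρ'
  have eσ := expand σ hσ hσ'
  rw [ih [invLetter x] (by simp), ih [y, x, invLetter y] (by simp), ih [y] (by simp),
    ih [invLetter x, x, invLetter y] (by simp), ih [x, invLetter y] (by simp),
    ih [x, y] (by simp), ih [x, x, invLetter y] (by simp), ih [invLetter x, y] (by simp),
    ih [invLetter y, x, y] (by simp), ih [x] (by simp),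
    wordTrace_eq_of_not_nodup hρ hσ (w := [x, invLetter y, x, y]) (by simp) ih] at eρ
  linear_combination eσ - eρ - h

/-- The traces of all words in two elements of `SL₃` and their inverses are determined by those
of nine words. -/
theorem wordTrace_eq_of_nine (hρ : ∀ l, ρ (invLetter l) = (ρ l).adjugate)
    (hσ : ∀ l, σ (invLetter l) = (σ l).adjugate)
    (hρ' : ∀ l, ρ l * ρ (invLetter l) = 1) (hσ' : ∀ l, σ l * σ (invLetter l) = 1)
    (h₁ : ∀ l, wordTrace ρ [l] = wordTrace σ [l])
    (h₂ : ∀ s t, wordTrace ρ [(true, s), (false, t)] = wordTrace σ [(true, s), (false, t)])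
    (h₄ : wordTrace ρ [(true, true), (false, true), (true, false), (false, false)] =
      wordTrace σ [(true, true), (false, true), (true, false), (false, false)])
    (w : List (Bool × Bool)) : wordTrace ρ w = wordTrace σ w := by
  induction hn : w.length using Nat.strong_induction_on generalizing w with
  | _ n IH =>
  subst hn
  have ih (v : List (Bool × Bool)) (hv : v.length < w.length) : wordTrace ρ v = wordTrace σ v :=
    IH _ hv v rfl
  have of_rotated {v : List (Bool × Bool)} (hv : w ~r v) (h : wordTrace ρ v = wordTrace σ v) :
      wordTrace ρ w = wordTrace σ w := by
    rwa [wordTrace_eq_of_isRotated ρ hv, wordTrace_eq_of_isRotated σ hv]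
  have of_cancel {x y : Bool × Bool} {v : List (Bool × Bool)} (hy : y = invLetter x)
      (hv : w ~r (x :: y :: v)) : wordTrace ρ w = wordTrace σ w := by
    subst hy
    refine of_rotated hv ?_
    rw [wordTrace_cons_cons_of_mul_eq_one ρ (hρ' x), wordTrace_cons_cons_of_mul_eq_one σ (hσ' x)]
    exact ih v (by simp [hv.perm.length_eq])
  by_cases hw : w.Nodup
  swap
  · exact wordTrace_eq_of_not_nodup hρ hσ hw ih
  have hlen : w.length ≤ 4 := hw.length_le_card
  match w with
  | [] => simp [wordTrace]
  | [a] => exact h₁ a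
  | [(true, s), (false, t)] => exact h₂ s t
  | [(false, s), (true, t)] => exact of_rotated ⟨1, rfl⟩ (h₂ t s)
  | [(true, s), (true, t)] | [(false, s), (false, t)] =>
    refine of_cancel (v := []) ?_ (.refl _)
    simpa [invLetter, eq_comm, Bool.eq_not] using hw
  | [a, b, c] =>
    rcases exists_adjacent_invLetter_of_nodup_three a b c hw with h | h | h
    · exact of_cancel h (.refl _)
    · exact of_cancel h ⟨1, rfl⟩
    · exact of_cancel h ⟨2, rfl⟩
  | [a, b, c, d] =>
    rcases exists_adjacent_invLetter_of_nodup_four a b c d hw with h | h | h | h | h | h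
    · exact of_cancel h (.refl _)
    · exact of_cancel h ⟨1, rfl⟩
    · exact of_cancel h ⟨2, rfl⟩
    · exact of_cancel h ⟨3, rfl⟩
    · exact of_rotated h h₄
    · exact of_rotated h (wordTrace_commutator_eq hρ hσ hρ' hσ' ih
        (x := (true, true)) (y := (false, true)) h₄)
  | _ :: _ :: _ :: _ :: _ :: _ =>
    simp only [List.length_cons] at hlen
    omega

end TwoGenerators

section Letters

variable {K : Type*} [Field K]

/-- The matrix `A`, `A⁻¹`, `B` or `B⁻¹` named by a letter. -/
noncomputable def letterMatrix (A B : Matrix (Fin 3) (Fin 3) K) (l : Bool × Bool) :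
    Matrix (Fin 3) (Fin 3) K :=
  let X := bif l.1 then A else B
  bif l.2 then X else X⁻¹

theorem letterMatrix_mul_invLetter {A B : Matrix (Fin 3) (Fin 3) K} (hA : A.det = 1)
    (hB : B.det = 1) (l : Bool × Bool) :
    letterMatrix A B l * letterMatrix A B (invLetter l) = 1 := by
  rcases l with ⟨_ | _, _ | _⟩ <;> simp [letterMatrix, invLetter, hA, hB]

theorem det_letterMatrix {A B : Matrix (Fin 3) (Fin 3) K} (hA : A.det = 1)
    (hB : B.det = 1) (l : Bool × Bool) : (letterMatrix A B l).det = 1 := by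
  rcases l with ⟨_ | _, _ | _⟩ <;> simp [letterMatrix, det_nonsing_inv, hA, hB]

theorem letterMatrix_invLetter {A B : Matrix (Fin 3) (Fin 3) K} (hA : A.det = 1)
    (hB : B.det = 1) (l : Bool × Bool) :
    letterMatrix A B (invLetter l) = (letterMatrix A B l).adjugate := by
  rw [← inv_eq_right_inv (letterMatrix_mul_invLetter hA hB l), inv_def, det_letterMatrix hA hB]
  simp

end Letters

end Matrix

theorem IsIrreduciblePair.eq_top_of_mem {A B : Matrix (Fin 3) (Fin 3) ℂ}
    (h : IsIrreduciblePair A B) {S : Subalgebra ℂ (Module.End ℂ (Fin 3 → ℂ))}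
    (hA : A.toLin' ∈ S) (hB : B.toLin' ∈ S) : S = ⊤ := by
  have : IsSimpleModule S (Fin 3 → ℂ) :=
    { toIsSimpleOrder :=
      { exists_pair_ne := ⟨⊥, ⊤, bot_ne_top⟩
        eq_bot_or_eq_top := fun W ↦ by
          rcases h (W.restrictScalars ℂ) (fun v hv ↦ W.smul_mem ⟨_, hA⟩ hv)
            (fun v hv ↦ W.smul_mem ⟨_, hB⟩ hv) with hW | hW
          · exact .inl (by simpa using hW)
          · exact .inr (by simpa using hW) } }
  exact S.eq_top_of_isSimpleModule

theorem lawton_trace_determine_irreducible_pair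
    (A B A' B' : Matrix (Fin 3) (Fin 3) ℂ)
    (hA : A.det = 1) (hB : B.det = 1) (hA' : A'.det = 1) (hB' : B'.det = 1)
    (hirr : IsIrreduciblePair A B)
    (h1 : A.trace = A'.trace)
    (h2 : B.trace = B'.trace)
    (h3 : (A * B).trace = (A' * B').trace)
    (h4 : (A⁻¹ * B).trace = (A'⁻¹ * B').trace)
    (h5 : (A⁻¹).trace = (A'⁻¹).trace)
    (h6 : (B⁻¹).trace = (B'⁻¹).trace)
    (h7 : (B⁻¹ * A⁻¹).trace = (B'⁻¹ * A'⁻¹).trace)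
    (h8 : (B⁻¹ * A).trace = (B'⁻¹ * A').trace)
    (h9 : (A * B * A⁻¹ * B⁻¹).trace = (A' * B' * A'⁻¹ * B'⁻¹).trace) :
    ∃ D : Matrix (Fin 3) (Fin 3) ℂ, D.det = 1 ∧
      A' = D * A * D⁻¹ ∧ B' = D * B * D⁻¹ := by
  let φ (X Y : Matrix (Fin 3) (Fin 3) ℂ) :
      MonoidAlgebra ℂ (FreeMonoid (Bool × Bool)) →ₐ[ℂ] Matrix (Fin 3) (Fin 3) ℂ :=
    MonoidAlgebra.lift ℂ _ _ (FreeMonoid.lift (letterMatrix X Y))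
  have hφA (X Y) : φ X Y (.of ℂ _ (.of (true, true))) = X := by simp [φ, letterMatrix]
  have hφB (X Y) : φ X Y (.of ℂ _ (.of (false, true))) = Y := by simp [φ, letterMatrix]
  have hsurj : Function.Surjective (φ A B) := fun M ↦ by
    have htop : ((toLinAlgEquiv' : Matrix (Fin 3) (Fin 3) ℂ ≃ₐ[ℂ] _).toAlgHom.comp
        (φ A B)).range = ⊤ :=
      hirr.eq_top_of_mem ⟨_, congr(toLinAlgEquiv' $(hφA A B))⟩
        ⟨_, congr(toLinAlgEquiv' $(hφB A B))⟩
    obtain ⟨r, hr⟩ := htop.ge (Algebra.mem_top (x := toLinAlgEquiv' M))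
    exact ⟨r, toLinAlgEquiv'.injective hr⟩
  have hword (w : List (Bool × Bool)) :
      wordTrace (letterMatrix A B) w = wordTrace (letterMatrix A' B') w := by
    refine wordTrace_eq_of_nine (letterMatrix_invLetter hA hB) (letterMatrix_invLetter hA' hB')
      (letterMatrix_mul_invLetter hA hB) (letterMatrix_mul_invLetter hA' hB') ?_ ?_ ?_ w
    · rintro ⟨_ | _, _ | _⟩ <;> simpa [wordTrace, letterMatrix]
    · rw [trace_mul_comm, trace_mul_comm B'⁻¹] at h7 h8
      rintro (_ | _) (_ | _) <;> simpa [wordTrace, letterMatrix]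
    · simpa [wordTrace, letterMatrix, mul_assoc] using h9
  have htrace (r) : (φ A B r).trace = (φ A' B' r).trace := by
    induction r using MonoidAlgebra.induction_on with
    | of w => simpa [φ, FreeMonoid.lift_apply, wordTrace] using hword w.toList
    | add r s hr hs => simp only [map_add, trace_add, hr, hs]
    | smul c r hr => simp only [map_smul, trace_smul, hr]
  obtain ⟨P, hP, hconj⟩ := exists_conj_of_trace_eq hsurj htrace
  obtain ⟨c, hc⟩ := IsAlgClosed.exists_pow_nat_eq P.det⁻¹ (n := 3) (by norm_num)
  have hP0 := hP.ne_zero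
  have hc0 : c ≠ 0 := fun h ↦ hP0 (by simpa [h, eq_comm] using hc)
  have hinv : (c • P)⁻¹ = c⁻¹ • P⁻¹ := inv_eq_right_inv (by simp [hc0, mul_nonsing_inv P hP])
  have hconj' (M) : c • P * M * (c • P)⁻¹ = P * M * P⁻¹ := by simp [hinv, hc0]
  refine ⟨c • P, by simp [hc, hP0], ?_, ?_⟩
  · simpa only [hφA, hconj'] using hconj (.of ℂ _ (.of (true, true)))
  · simpa only [hφB, hconj'] using hconj (.of ℂ _ (.of (false, true)))
end

section
/- Let A, B, C be in SL(3,ℂ) with CBA = I, and suppose tr(A) = tr(A⁻¹), tr(B) = tr(B⁻¹), tr(C) = tr(C⁻¹), σ₊(A,B,C) = σ₋(A,B,C) and tr([A,B]) = tr([B,A]). Write a = tr(A), b = tr(B), c = tr(C) and t = σ₊(A,B,C). Then either (1) t = 3 − a − b − c and tr([A,B]) = −abc + a² + b² + c² + ab + bc + ac − 3a − 3b − 3c + 3, or (2) t² − 2(a+b+c+1)t − 4abc + a² + b² + c² − 2ab − 2bc − 2ac − 2a − 2b − 2c − 3 = 0 and tr([A,B]) = (a+b+c+1)t + (a+1)(b+1)(c+1)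 − 1. -/
open Matrix

theorem trace_commutator_add (A B : Matrix (Fin 3) (Fin 3) ℂ) (hA : A.det = 1) (hB : B.det = 1) :
    (A * B * A.adjugate * B.adjugate).trace + (B * A * B.adjugate * A.adjugate).trace =
      A.trace * A.adjugate.trace * B.trace * B.adjugate.trace
      - A.trace * B.trace * (A.adjugate * B.adjugate).trace
      - A.adjugate.trace * B.adjugate.trace * (B * A).trace
      - A.trace * B.adjugate.trace * (A.adjugate * B).trace
      - A.adjugate.trace * B.trace * (B.adjugate * A).trace
      + A.trace * A.adjugate.trace + B.trace * B.adjugate.trace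
      + (B * A).trace * (A.adjugate * B.adjugate).trace
      + (A.adjugate * B).trace * (B.adjugate * A).trace - 3 := by
  have key : (A * B * A.adjugate * B.adjugate).trace + (B * A * B.adjugate * A.adjugate).trace =
      A.trace * A.adjugate.trace * B.trace * B.adjugate.trace
      - A.trace * B.trace * (A.adjugate * B.adjugate).trace
      - A.adjugate.trace * B.adjugate.trace * (B * A).trace
      - A.trace * B.adjugate.trace * (A.adjugate * B).trace
      - A.adjugate.trace * B.trace * (B.adjugate * A).trace
      + A.trace * A.adjugate.trace * B.det + B.trace * B.adjugate.trace * A.det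
      + (B * A).trace * (A.adjugate * B.adjugate).trace
      + (A.adjugate * B).trace * (B.adjugate * A).trace - 3 * A.det * B.det := by
    rw [adjugate_fin_three A, adjugate_fin_three B, det_fin_three, det_fin_three]
    simp only [trace_fin_three, mul_apply, Fin.sum_univ_three, of_apply,
      cons_val_zero, cons_val_one, cons_val]
    ring
  rw [hA, hB] at key
  linear_combination key

/-- For unimodular `A`, `B`, the vanishing determinant says that the two commutator traces agree. -/
structure IsSymmetricPair (A B : Matrix (Fin 3) (Fin 3) ℂ) : Prop where
  det_left : A.det = 1
  det_right : B.det = 1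
  trace_left : A.trace = (A⁻¹).trace
  trace_right : B.trace = (B⁻¹).trace
  trace_mul : (B * A).trace = (A⁻¹ * B⁻¹).trace
  trace_inv_mul : (A⁻¹ * B).trace = (B⁻¹ * A).trace
  det_commutator : (A * B - B * A).det = 0

/-- The two-component equation between the traces of `A`, `B`, `B * A` and the shape invariant. -/
def BranchRel (a b c t : ℂ) : Prop :=
  t = 3 - a - b - c ∨
    t ^ 2 - 2 * (a + b + c + 1) * t - 4 * a * b * c + a ^ 2 + b ^ 2 + c ^ 2
      - 2 * a * b - 2 * b * c - 2 * a * c - 2 * a - 2 * b - 2 * c - 3 = 0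

def OnBranchLocus (A B : Matrix (Fin 3) (Fin 3) ℂ) : Prop :=
  BranchRel A.trace B.trace (B * A).trace ((A⁻¹ * B).trace - A.trace * B.trace)

theorem inv_eq_adjugate_of_det_eq_one {A : Matrix (Fin 3) (Fin 3) ℂ} (hA : A.det = 1) :
    A⁻¹ = A.adjugate := by
  rw [inv_def, hA, Ring.inverse_one, one_smul]

theorem det_sub_one_fin_three (M : Matrix (Fin 3) (Fin 3) ℂ) :
    (M - 1).det = M.det - M.adjugate.trace + M.trace - 1 := by
  rw [adjugate_fin_three, det_fin_three, det_fin_three]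
  simp only [trace_fin_three, Matrix.sub_apply, one_apply, of_apply, cons_val]
  simp
  ring

theorem det_sub_smul_one_fin_three (M : Matrix (Fin 3) (Fin 3) ℂ) (z : ℂ) :
    (M - z • 1).det = M.det - z * M.adjugate.trace + z ^ 2 * M.trace - z ^ 3 := by
  rw [adjugate_fin_three, det_fin_three, det_fin_three]
  simp [trace_fin_three]
  ring

theorem pow_three_fin_three (M : Matrix (Fin 3) (Fin 3) ℂ) :
    M * (M * M) = M.trace • (M * M) - M.adjugate.trace • M + M.det • 1 := by
  rw [adjugate_fin_three, det_fin_three]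
  ext i j
  fin_cases i <;> fin_cases j <;>
    simp [trace_fin_three, mul_apply, Fin.sum_univ_three] <;> ring

theorem det_commutator_eq {A B : Matrix (Fin 3) (Fin 3) ℂ} (hA : A.det = 1) (hB : B.det = 1) :
    (A * B - B * A).det = (A * B * A⁻¹ * B⁻¹).trace - (B * A * B⁻¹ * A⁻¹).trace := by
  have uA : IsUnit A.det := by rw [hA]; exact isUnit_one
  have uB : IsUnit B.det := by rw [hB]; exact isUnit_one
  have hg : (A * B * A⁻¹ * B⁻¹).det = 1 := by
    simp [det_nonsing_inv, hA, hB]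
  have hinv : (A * B * A⁻¹ * B⁻¹)⁻¹ = B * A * B⁻¹ * A⁻¹ := by
    simp [Matrix.mul_inv_rev, nonsing_inv_nonsing_inv _ uA, nonsing_inv_nonsing_inv _ uB,
      Matrix.mul_assoc]
  have hfac : A * B - B * A = (A * B * A⁻¹ * B⁻¹ - 1) * (B * A) := by
    rw [sub_mul, one_mul, ← Matrix.mul_assoc, nonsing_inv_mul_cancel_right _ _ uB,
      nonsing_inv_mul_cancel_right _ _ uA]
  rw [hfac, det_mul, det_mul, hA, hB, det_sub_one_fin_three, hg,
    ← inv_eq_adjugate_of_det_eq_one hg, hinv]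
  ring

theorem IsSymmetricPair.onBranchLocus_of_conj {A B X P : Matrix (Fin 3) (Fin 3) ℂ}
    (h : IsSymmetricPair A B) (hP : IsUnit P) (hAP : A * P = P * X)
    (hX : ∀ Y, IsSymmetricPair X Y → OnBranchLocus X Y) : OnBranchLocus A B := by
  have hP' : IsUnit P.det := (isUnit_iff_isUnit_det P).1 hP
  obtain ⟨Y, rfl⟩ : ∃ Y, B = P * Y * P⁻¹ :=
    ⟨P⁻¹ * B * P, by
      rw [Matrix.mul_assoc P⁻¹, mul_nonsing_inv_cancel_left _ _ hP',
        mul_nonsing_inv_cancel_right _ _ hP']⟩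
  obtain rfl : A = P * X * P⁻¹ := by rw [← hAP, mul_nonsing_inv_cancel_right _ _ hP']
  have hmul (M N : Matrix (Fin 3) (Fin 3) ℂ) :
      P * M * P⁻¹ * (P * N * P⁻¹) = P * (M * N) * P⁻¹ := by
    simp only [Matrix.mul_assoc, nonsing_inv_mul_cancel_left _ _ hP']
  have hsub (M N : Matrix (Fin 3) (Fin 3) ℂ) :
      P * M * P⁻¹ - P * N * P⁻¹ = P * (M - N) * P⁻¹ := by
    rw [mul_sub, sub_mul]
  have hinv (M : Matrix (Fin 3) (Fin 3) ℂ) : (P * M * P⁻¹)⁻¹ = P * M⁻¹ * P⁻¹ := by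
    simp [Matrix.mul_inv_rev, nonsing_inv_nonsing_inv _ hP', Matrix.mul_assoc]
  have key : IsSymmetricPair X Y := by
    obtain ⟨h1, h2, h3, h4, h5, h6, h7⟩ := h
    simp only [hmul, hsub, hinv, trace_conj hP, det_conj hP] at h1 h2 h3 h4 h5 h6 h7
    exact ⟨h1, h2, h3, h4, h5, h6, h7⟩
  simpa only [OnBranchLocus, hmul, hinv, trace_conj hP] using hX Y key

theorem exists_isUnit_of_basis {A X : Matrix (Fin 3) (Fin 3) ℂ} {v₁ v₂ v₃ : Fin 3 → ℂ}
    (hli : ∀ x y z : ℂ, x • v₁ + y • v₂ + z • v₃ = 0 → x = 0 ∧ y = 0 ∧ z = 0)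
    (h₁ : A *ᵥ v₁ = X 0 0 • v₁ + X 1 0 • v₂ + X 2 0 • v₃)
    (h₂ : A *ᵥ v₂ = X 0 1 • v₁ + X 1 1 • v₂ + X 2 1 • v₃)
    (h₃ : A *ᵥ v₃ = X 0 2 • v₁ + X 1 2 • v₂ + X 2 2 • v₃) :
    ∃ P : Matrix (Fin 3) (Fin 3) ℂ, IsUnit P ∧ A * P = P * X := by
  refine ⟨(of ![v₁, v₂, v₃])ᵀ, ?_, ?_⟩
  · rw [← linearIndependent_cols_iff_isUnit, Fintype.linearIndependent_iff]
    intro g hg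
    rw [Fin.sum_univ_three] at hg
    have := hli (g 0) (g 1) (g 2) hg
    intro i
    fin_cases i
    exacts [this.1, this.2.1, this.2.2]
  · ext i j
    have e₁ := congrFun h₁ i
    have e₂ := congrFun h₂ i
    have e₃ := congrFun h₃ i
    simp only [mulVec, dotProduct, Fin.sum_univ_three, Pi.add_apply, Pi.smul_apply,
      smul_eq_mul] at e₁ e₂ e₃
    fin_cases j <;> simp [mul_apply, Fin.sum_univ_three]
    · linear_combination e₁
    · linear_combination e₂
    · linear_combination e₃

theorem diagonal_dichotomy_of_entries {x y b11 b12 b13 b21 b22 b23 b31 b32 b33 m11 m22 m33 : ℂ}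
    (hxy : x * y = 1) (h1 : x ≠ y) (h2 : x ≠ 1) (h3 : y ≠ 1)
    (e11 : m11 = b22 * b33 - b23 * b32) (e22 : m22 = b11 * b33 - b13 * b31)
    (e33 : m33 = b11 * b22 - b12 * b21)
    (hdet : b11 * m11 - b12 * b21 * b33 + b12 * b23 * b31 + b13 * b21 * b32 - b13 * b22 * b31 = 1)
    (htr : b11 + b22 + b33 = m11 + m22 + m33)
    (hc : b11 + x * b22 + y * b33 = m11 + y * m22 + x * m33)
    (hs : b11 + y * b22 + x * b33 = m11 + x * m22 + y * m33)
    (hD : (x - y) * (x - 1) * (y - 1) * (b12 * b23 * b31 - b13 * b21 * b32) = 0) :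
    b11 = 1 ∨ 4 * b22 * b33 = (b11 + 1) ^ 2 := by
  have n1 := sub_ne_zero.2 h1
  have n2 := sub_ne_zero.2 h2
  have n3 := sub_ne_zero.2 h3
  have k1 : m11 = b11 := by
    have : (x - 1) * (y - 1) * (m11 - b11) = 0 := by grind
    grind
  have k2 : m22 = b33 := by
    have : (x - y) * (m22 - b33) = 0 := by grind
    grind
  have k3 : m33 = b22 := by grind
  have k4 : b12 * b23 * b31 = b13 * b21 * b32 := by grind
  have p1 : 2 * (b12 * b23 * b31) = (b11 - 1) * (2 * b22 * b33 - b11 - 1) := by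
    rw [k1] at e11 hdet
    rw [k2] at e22
    rw [k3] at e33
    linear_combination hdet + k4 + b33 * e33 + b22 * e22
  have p2 : (b12 * b23 * b31) ^ 2 = (b11 - 1) ^ 2 * (b22 * b33) * (b22 * b33 - b11) := by
    have hsq : (b12 * b23 * b31) ^ 2 = (b12 * b21) * (b23 * b32) * (b13 * b31) := by
      linear_combination (b12 * b23 * b31) * k4
    have q1 : b12 * b21 = b22 * (b11 - 1) := by linear_combination e33 - k3
    have q2 : b13 * b31 = b33 * (b11 - 1) := by linear_combination e22 - k2
    have q3 : b23 * b32 = b22 * b33 - b11 := by linear_combination e11 - k1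
    rw [hsq, q1, q2, q3]
    ring
  have hprod : (b11 - 1) ^ 2 * ((b11 + 1) ^ 2 - 4 * b22 * b33) = 0 := by
    linear_combination
      (-2 * (b12 * b23 * b31) - (b11 - 1) * (2 * b22 * b33 - b11 - 1)) * p1 + 4 * p2
  rcases mul_eq_zero.1 hprod with h | h
  · left
    exact sub_eq_zero.1 (pow_eq_zero_iff two_ne_zero |>.1 h)
  · right
    linear_combination -h

theorem quadratic_eq_zero_of_diagonal_entries {x y d1 d2 d3 a b c t : ℂ} (hxy : x * y = 1)
    (h : 4 * d2 * d3 = (d1 + 1) ^ 2) (ha : a = 1 + x + y) (hb : b = d1 + d2 + d3)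
    (hc : c = d1 + x * d2 + y * d3) (ht : t = d1 + y * d2 + x * d3 - a * b) :
    t ^ 2 - 2 * (a + b + c + 1) * t - 4 * a * b * c + a ^ 2 + b ^ 2 + c ^ 2
      - 2 * a * b - 2 * b * c - 2 * a * c - 2 * a - 2 * b - 2 * c - 3 = 0 := by
  grind

theorem quadratic_eq_zero_of_unipotent_entries
    {b11 b12 b13 b21 b22 b23 b31 b32 b33 b c t : ℂ} (hr : b31 ≠ 0)
    (hdet : b11 * (b22 * b33 - b23 * b32) - b12 * b21 * b33 + b12 * b23 * b31
      + b13 * b21 * b32 - b13 * b22 * b31 = 1)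
    (htr : b11 + b22 + b33 = (b22 * b33 - b23 * b32) + (b11 * b33 - b13 * b31)
      + (b11 * b22 - b12 * b21))
    (h31 : b21 * b32 - b22 * b31 = b31)
    (hk : (b23 * b31 - b21 * b33) + (b12 * b31 - b11 * b32) = b31 - (b21 + b32))
    (hD : b21 * ((b32 - b21) * (-b32) + b31 * (b33 - b22))
      - b31 * ((b22 - b11) * (-b32) + b31 * (b23 - b12)) = 0)
    (hb : b = b11 + b22 + b33) (hc : c = b + b21 + b32)
    (ht : t = -2 * b - (b21 + b32) + b31) :
    t ^ 2 - 2 * (3 + b + c + 1) * t - 4 * 3 * b * c + 3 ^ 2 + b ^ 2 + c ^ 2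
      - 2 * 3 * b - 2 * b * c - 2 * 3 * c - 2 * 3 - 2 * b - 2 * c - 3 = 0 := by
  obtain ⟨p, rfl⟩ : ∃ p, b32 = b31 * p := ⟨b32 / b31, by field_simp⟩
  obtain ⟨m, rfl⟩ : ∃ m, b21 = b31 * m := ⟨b21 / b31, by field_simp⟩
  obtain rfl : b22 = b31 * m * p - 1 := by
    apply mul_left_cancel₀ hr
    linear_combination -h31
  have hsub : b23 - b12 = m * ((p - m) * (-b31 * p) + b33 - (b31 * m * p - 1))
      + p * ((b31 * m * p - 1) - b11) := by
    apply mul_left_cancel₀ (pow_ne_zero 2 hr)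
    linear_combination -hD
  have hadd : b23 + b12 = m * b33 + p * b11 + 1 - (m + p) := by
    apply mul_left_cancel₀ hr
    linear_combination hk
  obtain ⟨w, hw⟩ : ∃ w, w = b13 * b31 := ⟨_, rfl⟩
  have hw' : w = (b31 * m * p - 1) * b33 - b23 * b31 * p + b11 * b33
      + b11 * (b31 * m * p - 1) - b12 * b31 * m - (b11 + (b31 * m * p - 1) + b33) := by
    linear_combination hw + htr
  have hdet' : b11 * ((b31 * m * p - 1) * b33 - b23 * b31 * p) - b12 * b31 * m * b33
      + b12 * b23 * b31 + w = 1 := by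
    linear_combination hdet + hw
  clear hdet htr h31 hk hD hw
  have h23 : b23 = ((m * ((p - m) * (-b31 * p) + b33 - (b31 * m * p - 1))
      + p * ((b31 * m * p - 1) - b11)) + (m * b33 + p * b11 + 1 - (m + p))) / 2 := by
    linear_combination (hsub + hadd) / 2
  have h12 : b12 = (-(m * ((p - m) * (-b31 * p) + b33 - (b31 * m * p - 1))
      + p * ((b31 * m * p - 1) - b11)) + (m * b33 + p * b11 + 1 - (m + p))) / 2 := by
    linear_combination (hadd - hsub) / 2
  clear hsub hadd
  subst h23 h12 hc ht hb hw'
  grind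

theorem fixed_entry_eq_one_of_neg_jordan_entries
    {b11 b12 b13 b21 b22 b23 b31 b32 b33 : ℂ} (hr : b32 ≠ 0)
    (h11 : b22 * b33 - b23 * b32 = b11)
    (hdet : b11 * (b22 * b33 - b23 * b32) - b12 * b21 * b33 + b12 * b23 * b31
      + b13 * b21 * b32 - b13 * b22 * b31 = 1)
    (htr : b11 + b22 + b33 = (b22 * b33 - b23 * b32) + (b11 * b33 - b13 * b31)
      + (b11 * b22 - b12 * b21))
    (h32 : b12 * b31 - b11 * b32 = -b32)
    (hD : b32 * b12 * b21 + b12 * b31 * (b33 - b22) = b32 * b13 * b31) : b11 = 1 := by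
  grind

theorem onBranchLocus_diagonal {x y : ℂ} (hxy : x * y = 1) (h1 : x ≠ y) (h2 : x ≠ 1) (h3 : y ≠ 1)
    (B : Matrix (Fin 3) (Fin 3) ℂ) (h : IsSymmetricPair !![1, 0, 0; 0, x, 0; 0, 0, y] B) :
    OnBranchLocus !![1, 0, 0; 0, x, 0; 0, 0, y] B := by
  obtain ⟨hA, hB, -, htB, hc, hs, hD⟩ := h
  rw [OnBranchLocus]
  rw [inv_eq_adjugate_of_det_eq_one hA] at *
  rw [inv_eq_adjugate_of_det_eq_one hB] at *
  rw [adjugate_fin_three, adjugate_fin_three] at *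
  rw [det_fin_three] at *
  simp [trace_fin_three, mul_apply, vecMul, dotProduct, Fin.sum_univ_three] at htB hB hc hs hD ⊢
  rw [hxy] at hc hs ⊢
  have key := diagonal_dichotomy_of_entries (b11 := B 0 0) (b12 := B 0 1) (b13 := B 0 2) (b21 := B 1 0)
      (b22 := B 1 1) (b23 := B 1 2) (b31 := B 2 0) (b32 := B 2 1) (b33 := B 2 2)
      hxy h1 h2 h3 rfl rfl rfl (by linear_combination hB) (by linear_combination htB)
    (by linear_combination hc) (by linear_combination hs) (by linear_combination -hD)
  rcases key with key | key
  · left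
    linear_combination (2 - x - y) * key
  · right
    exact quadratic_eq_zero_of_diagonal_entries hxy key rfl rfl (by ring) (by ring)

theorem onBranchLocus_unipotent
    (B : Matrix (Fin 3) (Fin 3) ℂ) (h : IsSymmetricPair !![1, 1, 0; 0, 1, 1; 0, 0, 1] B) :
    OnBranchLocus !![1, 1, 0; 0, 1, 1; 0, 0, 1] B := by
  obtain ⟨hA, hB, -, htB, hc, hs, hD⟩ := h
  rw [OnBranchLocus]
  rw [inv_eq_adjugate_of_det_eq_one hA] at *
  rw [inv_eq_adjugate_of_det_eq_one hB] at *
  rw [adjugate_fin_three, adjugate_fin_three] at *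
  rw [det_fin_three] at *
  simp [trace_fin_three, mul_apply, vecMul, dotProduct, Fin.sum_univ_three] at htB hB hc hs hD ⊢
  norm_num
  by_cases hr : B 2 0 = 0
  · left
    linear_combination hr
  · right
    exact quadratic_eq_zero_of_unipotent_entries (b11 := B 0 0) (b12 := B 0 1) (b13 := B 0 2) (b21 := B 1 0)
      (b22 := B 1 1) (b23 := B 1 2) (b31 := B 2 0) (b32 := B 2 1) (b33 := B 2 2) hr
      (by linear_combination hB) (by linear_combination htB)
      (by linear_combination 2 * htB - hc - hs)
      (by linear_combination htB - hs) (by linear_combination hD) rfl (by ring) (by ring)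

theorem onBranchLocus_neg_jordan
    (B : Matrix (Fin 3) (Fin 3) ℂ) (h : IsSymmetricPair !![1, 0, 0; 0, -1, 1; 0, 0, -1] B) :
    OnBranchLocus !![1, 0, 0; 0, -1, 1; 0, 0, -1] B := by
  obtain ⟨hA, hB, -, htB, hc, hs, hD⟩ := h
  rw [OnBranchLocus]
  rw [inv_eq_adjugate_of_det_eq_one hA] at *
  rw [inv_eq_adjugate_of_det_eq_one hB] at *
  rw [adjugate_fin_three, adjugate_fin_three] at *
  rw [det_fin_three] at *
  simp [trace_fin_three, mul_apply, vecMul, dotProduct, Fin.sum_univ_three] at htB hB hc hs hD ⊢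
  by_cases hr : B 2 1 = 0
  · right
    rw [hr]
    ring
  · left
    have key := fixed_entry_eq_one_of_neg_jordan_entries (b11 := B 0 0) (b12 := B 0 1) (b13 := B 0 2) (b21 := B 1 0)
      (b22 := B 1 1) (b23 := B 1 2) (b31 := B 2 0) (b32 := B 2 1) (b33 := B 2 2) hr
      (by grind)
      (by linear_combination hB) (by linear_combination htB) (by linear_combination hc/2 - hs/2)
      (by linear_combination - hD / 4)
    linear_combination 4 * key

theorem onBranchLocus_of_sub_one_sq {A : Matrix (Fin 3) (Fin 3) ℂ} (B : Matrix (Fin 3) (Fin 3) ℂ)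
    (hA : A.trace = 3) (h : (A - 1) * (A - 1) = 0) : OnBranchLocus A B := by
  have hinv : A⁻¹ = 2 • 1 - A := by
    refine inv_eq_right_inv ?_
    have : A * (2 • 1 - A) = 1 - (A - 1) * (A - 1) := by noncomm_ring
    rw [this, h, sub_zero]
  left
  rw [hinv, sub_mul, trace_sub, smul_mul_assoc, one_mul, trace_smul, trace_mul_comm A B, hA]
  simp
  ring

theorem onBranchLocus_of_sq_eq_one {A : Matrix (Fin 3) (Fin 3) ℂ} (B : Matrix (Fin 3) (Fin 3) ℂ)
    (hA : A.trace = -1) (h : A * A = 1) : OnBranchLocus A B := by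
  right
  rw [inv_eq_right_inv h, trace_mul_comm A B, hA]
  ring

theorem exists_eigenvector {A : Matrix (Fin 3) (Fin 3) ℂ} {z : ℂ} (h : (A - z • 1).det = 0) :
    ∃ v ≠ 0, A *ᵥ v = z • v := by
  obtain ⟨v, hv, h⟩ := exists_mulVec_eq_zero_iff.2 h
  refine ⟨v, hv, ?_⟩
  rwa [sub_mulVec, smul_mulVec, one_mulVec, sub_eq_zero] at h

theorem exists_mulVec_ne_zero {M : Matrix (Fin 3) (Fin 3) ℂ} (h : M ≠ 0) : ∃ v, M *ᵥ v ≠ 0 := by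
  by_contra! hM
  exact h (ext_of_mulVec_single fun i => by rw [hM, zero_mulVec])

theorem IsSymmetricPair.onBranchLocus_of_eigenvalues {A B : Matrix (Fin 3) (Fin 3) ℂ}
    (h : IsSymmetricPair A B) {x y : ℂ} (hxy : x * y = 1) (htr : A.trace = 1 + x + y)
    (h1 : x ≠ y) (h2 : x ≠ 1) (h3 : y ≠ 1) : OnBranchLocus A B := by
  have hdet (z : ℂ) (hz : (z - 1) * (z - x) * (z - y) = 0) : (A - z • 1).det = 0 := by
    rw [det_sub_smul_one_fin_three, ← inv_eq_adjugate_of_det_eq_one h.det_left, ← h.trace_left,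
      htr, h.det_left]
    linear_combination -hz - (1 - z) * hxy
  obtain ⟨v₁, hv₁, e₁⟩ := exists_eigenvector (hdet 1 (by ring))
  obtain ⟨v₂, hv₂, e₂⟩ := exists_eigenvector (hdet x (by ring))
  obtain ⟨v₃, hv₃, e₃⟩ := exists_eigenvector (hdet y (by ring))
  obtain ⟨P, hP, hAP⟩ := exists_isUnit_of_basis (A := A) (X := !![1, 0, 0; 0, x, 0; 0, 0, y])
    (v₁ := v₁) (v₂ := v₂) (v₃ := v₃) (by
      intro r s t hr
      have hA := congrArg (A *ᵥ ·) hr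
      simp only [mulVec_add, mulVec_smul, e₁, e₂, e₃, mulVec_zero] at hA
      have hAA := congrArg (A *ᵥ ·) hA
      simp only [mulVec_add, mulVec_smul, e₁, e₂, e₃, mulVec_zero] at hAA
      have k₁ : (r * ((x - 1) * (y - 1))) • v₁ = 0 := by
        linear_combination (norm := module) hAA - (x + y) • hA + (x * y) • hr
      have k₂ : (s * ((x - 1) * (x - y))) • v₂ = 0 := by
        linear_combination (norm := module) hAA - (1 + y) • hA + y • hr
      have k₃ : (t * ((y - 1) * (x - y))) • v₃ = 0 := by
        linear_combination (norm := module) -hAA + (1 + x) • hA - x • hr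
      simpa [hv₁, hv₂, hv₃, sub_eq_zero, h1, h2, h3] using And.intro k₁ (And.intro k₂ k₃))
    (by simpa using e₁) (by simpa using e₂) (by simpa using e₃)
  exact h.onBranchLocus_of_conj hP hAP (onBranchLocus_diagonal hxy h1 h2 h3)

theorem IsSymmetricPair.onBranchLocus_of_trace_eq_three {A B : Matrix (Fin 3) (Fin 3) ℂ}
    (h : IsSymmetricPair A B) (htr : A.trace = 3) : OnBranchLocus A B := by
  by_cases hN : (A - 1) * (A - 1) = 0
  · exact onBranchLocus_of_sub_one_sq B htr hN
  have hcube : (A - 1) * ((A - 1) * (A - 1)) = 0 := by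
    have := pow_three_fin_three A
    rw [← inv_eq_adjugate_of_det_eq_one h.det_left, ← h.trace_left, htr, h.det_left] at this
    have e : (A - 1) * ((A - 1) * (A - 1)) =
        A * (A * A) - ((3 : ℂ) • (A * A) - (3 : ℂ) • A + (1 : ℂ) • 1) := by
      simp only [ofNat_smul_eq_nsmul ℂ, one_smul]
      noncomm_ring
    rw [e, this, sub_self]
  obtain ⟨v, hv⟩ := exists_mulVec_ne_zero hN
  set v₂ := (A - 1) *ᵥ v with hv₂
  set v₁ := (A - 1) *ᵥ v₂ with hv₁
  have hv₁0 : v₁ ≠ 0 := by rwa [hv₁, hv₂, mulVec_mulVec]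
  have e₁ : A *ᵥ v₁ = v₁ := by
    have : (A - 1) *ᵥ v₁ = 0 := by
      rw [hv₁, hv₂, mulVec_mulVec, mulVec_mulVec, Matrix.mul_assoc, hcube, zero_mulVec]
    rwa [sub_mulVec, one_mulVec, sub_eq_zero] at this
  have e₂ : A *ᵥ v₂ = v₁ + v₂ := by rw [hv₁, sub_mulVec, one_mulVec, sub_add_cancel]
  have e₃ : A *ᵥ v = v₂ + v := by rw [hv₂, sub_mulVec, one_mulVec, sub_add_cancel]
  clear_value v₁ v₂
  obtain ⟨P, hP, hAP⟩ := exists_isUnit_of_basis (A := A) (X := !![1, 1, 0; 0, 1, 1; 0, 0, 1])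
    (v₁ := v₁) (v₂ := v₂) (v₃ := v) (by
      intro r s t hr
      have hA := congrArg (A *ᵥ ·) hr
      simp only [mulVec_add, mulVec_smul, e₁, e₂, e₃, mulVec_zero] at hA
      have hAA := congrArg (A *ᵥ ·) hA
      simp only [mulVec_add, mulVec_smul, e₁, e₂, e₃, mulVec_zero] at hAA
      have k₃ : t • v₁ = 0 := by
        linear_combination (norm := module) hAA - (2 : ℂ) • hA + hr
      obtain rfl : t = 0 := by simpa [hv₁0] using k₃
      have k₂ : s • v₁ = 0 := by
        linear_combination (norm := module) hA - hr
      obtain rfl : s = 0 := by simpa [hv₁0] using k₂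
      simpa [hv₁0] using hr)
    (by simpa using e₁) (by simpa using e₂) (by simpa using e₃)
  exact h.onBranchLocus_of_conj hP hAP onBranchLocus_unipotent

theorem IsSymmetricPair.onBranchLocus_of_trace_eq_neg_one {A B : Matrix (Fin 3) (Fin 3) ℂ}
    (h : IsSymmetricPair A B) (htr : A.trace = -1) : OnBranchLocus A B := by
  by_cases hN : (A + 1) * (A - 1) = 0
  · refine onBranchLocus_of_sq_eq_one B htr ?_
    rw [← sub_eq_zero, ← hN]
    noncomm_ring
  have hcube : (A + 1) * ((A + 1) * (A - 1)) = 0 := by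
    have := pow_three_fin_three A
    rw [← inv_eq_adjugate_of_det_eq_one h.det_left, ← h.trace_left, htr, h.det_left] at this
    have e : (A + 1) * ((A + 1) * (A - 1)) =
        A * (A * A) - ((-1 : ℂ) • (A * A) - (-1 : ℂ) • A + (1 : ℂ) • 1) := by
      simp only [neg_smul, one_smul]
      noncomm_ring
    rw [e, this, sub_self]
  obtain ⟨v₁, hv₁, e₁⟩ := exists_eigenvector (A := A) (z := 1) (by
    rw [det_sub_smul_one_fin_three, ← inv_eq_adjugate_of_det_eq_one h.det_left, ← h.trace_left,
      htr, h.det_left]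
    ring)
  rw [one_smul] at e₁
  obtain ⟨v, hv⟩ := exists_mulVec_ne_zero hN
  set v₃ := (A - 1) *ᵥ v with hv₃
  set v₂ := (A + 1) *ᵥ v₃ with hv₂
  have hv₂0 : v₂ ≠ 0 := by rwa [hv₂, hv₃, mulVec_mulVec]
  have e₂ : A *ᵥ v₂ = -v₂ := by
    have : (A + 1) *ᵥ v₂ = 0 := by
      rw [hv₂, hv₃, mulVec_mulVec, mulVec_mulVec, Matrix.mul_assoc, hcube, zero_mulVec]
    rwa [add_mulVec, one_mulVec, add_eq_zero_iff_eq_neg] at this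
  have e₃ : A *ᵥ v₃ = v₂ - v₃ := by rw [hv₂, add_mulVec, one_mulVec, add_sub_cancel_right]
  clear_value v₂ v₃
  obtain ⟨P, hP, hAP⟩ := exists_isUnit_of_basis (A := A) (X := !![1, 0, 0; 0, -1, 1; 0, 0, -1])
    (v₁ := v₁) (v₂ := v₂) (v₃ := v₃) (by
      intro r s t hr
      have hA := congrArg (A *ᵥ ·) hr
      simp only [mulVec_add, mulVec_smul, e₁, e₂, e₃, mulVec_zero] at hA
      have hAA := congrArg (A *ᵥ ·) hA
      simp only [mulVec_add, mulVec_sub, mulVec_neg, mulVec_smul, e₁, e₂, e₃, mulVec_zero] at hAA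
      have k₃ : t • v₂ = 0 := by
        linear_combination (norm := module) (-1 / 2 : ℂ) • hAA + (1 / 2 : ℂ) • hr
      obtain rfl : t = 0 := by simpa [hv₂0] using k₃
      have k₂ : s • v₂ = 0 := by
        linear_combination (norm := module) (1 / 2 : ℂ) • hr - (1 / 2 : ℂ) • hA
      obtain rfl : s = 0 := by simpa [hv₂0] using k₂
      simpa [hv₁] using hr)
    (by simpa using e₁) (by simpa using e₂) (by simpa [sub_eq_add_neg] using e₃)
  exact h.onBranchLocus_of_conj hP hAP onBranchLocus_neg_jordan

theorem IsSymmetricPair.onBranchLocus {A B : Matrix (Fin 3) (Fin 3) ℂ}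
    (h : IsSymmetricPair A B) : OnBranchLocus A B := by
  obtain ⟨s, hs⟩ := IsAlgClosed.exists_pow_nat_eq ((A.trace - 1) ^ 2 - 4) (n := 2) two_pos
  obtain ⟨x, y, hxy, htr⟩ : ∃ x y : ℂ, x * y = 1 ∧ A.trace = 1 + x + y :=
    ⟨(A.trace - 1 + s) / 2, (A.trace - 1 - s) / 2, by linear_combination -hs / 4, by ring⟩
  by_cases h2 : x = 1
  · subst h2
    exact h.onBranchLocus_of_trace_eq_three (by linear_combination htr + hxy)
  by_cases h3 : y = 1
  · subst h3
    exact h.onBranchLocus_of_trace_eq_three (by linear_combination htr + hxy)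
  by_cases h1 : x = y
  · subst h1
    obtain rfl := (mul_self_eq_one_iff.1 hxy).resolve_left h2
    exact h.onBranchLocus_of_trace_eq_neg_one (by linear_combination htr)
  exact h.onBranchLocus_of_eigenvalues hxy htr h1 h2 h3

theorem branching_locus_factorisation
    (A B C : Matrix (Fin 3) (Fin 3) ℂ)
    (hA : A.det = 1) (hB : B.det = 1) (hC : C.det = 1)
    (h : C * B * A = 1)
    (hAtr : A.trace = (A⁻¹).trace)
    (hBtr : B.trace = (B⁻¹).trace)
    (hCtr : C.trace = (C⁻¹).trace)
    (hσ : (A⁻¹ * B).trace - (A⁻¹).trace * B.trace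
        = (B⁻¹ * A).trace - (B⁻¹).trace * A.trace)
    (hcomm : (A * B * A⁻¹ * B⁻¹).trace = (B * A * B⁻¹ * A⁻¹).trace) :
    (let a := A.trace; let b := B.trace; let c := C.trace;
     let t := (A⁻¹ * B).trace - (A⁻¹).trace * B.trace;
     (t = 3 - a - b - c ∧
       (A * B * A⁻¹ * B⁻¹).trace
         = -(a * b * c) + a ^ 2 + b ^ 2 + c ^ 2 + a * b + b * c + a * c
           - 3 * a - 3 * b - 3 * c + 3) ∨
     (t ^ 2 - 2 * (a + b + c + 1) * t - 4 * a * b * c + a ^ 2 + b ^ 2 + c ^ 2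
        - 2 * a * b - 2 * b * c - 2 * a * c - 2 * a - 2 * b - 2 * c - 3 = 0 ∧
       (A * B * A⁻¹ * B⁻¹).trace
         = (a + b + c + 1) * t + (a + 1) * (b + 1) * (c + 1) - 1)) := by
  have uA : IsUnit A.det := by rw [hA]; exact isUnit_one
  have uB : IsUnit B.det := by rw [hB]; exact isUnit_one
  have hCinv : C⁻¹ = B * A := inv_eq_right_inv (by rw [← Matrix.mul_assoc, h])
  have hC' : C = A⁻¹ * B⁻¹ := by
    rw [← Matrix.mul_inv_rev, ← hCinv,
      nonsing_inv_nonsing_inv _ (by rw [hC]; exact isUnit_one)]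
  rw [hCinv] at hCtr
  have hmul : (A⁻¹ * B⁻¹).trace = (B * A).trace := by rw [← hC', hCtr]
  have hinv : (A⁻¹ * B).trace = (B⁻¹ * A).trace := by
    linear_combination hσ + A.trace * hBtr - B.trace * hAtr
  have hpair : IsSymmetricPair A B :=
    ⟨hA, hB, hAtr, hBtr, hmul.symm, hinv, by
      rw [det_commutator_eq hA hB, hcomm, sub_self]⟩
  have hsum := trace_commutator_add A B hA hB
  rw [← inv_eq_adjugate_of_det_eq_one hA, ← inv_eq_adjugate_of_det_eq_one hB, ← hcomm, hmul,
    ← hinv, ← hAtr, ← hBtr] at hsum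
  have key := hpair.onBranchLocus
  rw [OnBranchLocus] at key
  simp only [hCtr, ← hAtr]
  generalize (A * B * A⁻¹ * B⁻¹).trace = k at *
  generalize (A⁻¹ * B).trace = e at *
  refine key.imp (fun ht => ⟨ht, ?_⟩) (fun ht => ⟨ht, ?_⟩)
  · linear_combination hsum / 2 +
      (e - A.trace * B.trace + 3 - A.trace - B.trace - (B * A).trace) / 2 * ht
  · linear_combination hsum / 2 + ht / 2
end

section
/- Let A, B, C be in SL(3,ℂ) satisfying: CBA = I; tr(A⁻¹) = tr(A), tr(B⁻¹) = tr(B), tr(C⁻¹) = tr(C) and tr([A,B]⁻¹) = tr([A,B]); and σ₊(A,B,C) = σ₋(A,B,C). If σ₊(A,B,C) = 3 − tr(A) − tr(B) − tr(C), then the pair {A, B} is reducible, i.e. there exists a ℂ-linear subspace W of ℂ³ with W ≠ {0}, W ≠ ℂ³, A·W ⊆ W and B·W ⊆ W. -/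
open Matrix

/-- The pair `A`, `B` has a common invariant subspace which is neither zero nor everything. -/
def HasCommonInvariantSubspace (A B : Matrix (Fin 3) (Fin 3) ℂ) : Prop :=
  ∃ W : Submodule ℂ (Fin 3 → ℂ), W ≠ ⊥ ∧ W ≠ ⊤ ∧
    (∀ v ∈ W, A *ᵥ v ∈ W) ∧ (∀ v ∈ W, B *ᵥ v ∈ W)

theorem HasCommonInvariantSubspace.symm {A B : Matrix (Fin 3) (Fin 3) ℂ}
    (h : HasCommonInvariantSubspace A B) : HasCommonInvariantSubspace B A := by
  obtain ⟨W, h1, h2, h3, h4⟩ := h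
  exact ⟨W, h1, h2, h4, h3⟩

theorem hasCommonInvariantSubspace_of_mulVec {A B : Matrix (Fin 3) (Fin 3) ℂ}
    {n : Fin 3 → ℂ} (hn : n ≠ 0) {a b : ℂ} (hA : A *ᵥ n = a • n) (hB : B *ᵥ n = b • n) :
    HasCommonInvariantSubspace A B := by
  refine ⟨Submodule.span ℂ {n}, by simpa using hn, ?_, ?_, ?_⟩
  · intro h
    have h1 := finrank_span_singleton (K := ℂ) hn
    rw [h, finrank_top] at h1
    simp at h1
  all_goals
    intro v hv
    obtain ⟨c, rfl⟩ := Submodule.mem_span_singleton.1 hv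
    simp only [mulVec_smul, hA, hB]
    exact Submodule.smul_mem _ _ (Submodule.smul_mem _ _ (Submodule.mem_span_singleton_self n))

theorem hasCommonInvariantSubspace_of_vecMul {A B : Matrix (Fin 3) (Fin 3) ℂ}
    {n : Fin 3 → ℂ} (hn : n ≠ 0) {a b : ℂ} (hA : n ᵥ* A = a • n) (hB : n ᵥ* B = b • n) :
    HasCommonInvariantSubspace A B := by
  have mem : ∀ v, v ∈ LinearMap.ker (dotProductBilin ℂ ℂ n) ↔ n ⬝ᵥ v = 0 := by
    intro v; simp [LinearMap.mem_ker]
  refine ⟨LinearMap.ker (dotProductBilin ℂ ℂ n), ?_, ?_, ?_, ?_⟩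
  · intro h
    have h1 := LinearMap.finrank_range_add_finrank_ker (dotProductBilin ℂ ℂ n)
    have h2 := Submodule.finrank_le (LinearMap.range (dotProductBilin ℂ ℂ n))
    rw [h] at h1
    simp at h1 h2
    omega
  · intro h
    apply hn
    apply dotProduct_eq_zero
    intro w
    rw [← mem, h]
    trivial
  all_goals
    intro v hv
    rw [mem] at hv ⊢
    simp [dotProduct_mulVec, hA, hB, hv]

theorem exists_eq_smul_of_cross_eq_zero {p q : Fin 3 → ℂ} (hq : q ≠ 0) (h : p ⨯₃ q = 0) :
    ∃ c : ℂ, p = c • q := by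
  obtain ⟨i, hi⟩ := Function.ne_iff.1 hq
  have h0 := congrFun h 0
  have h1 := congrFun h 1
  have h2 := congrFun h 2
  simp [cross_apply] at h0 h1 h2 hi
  refine ⟨p i / q i, ?_⟩
  ext j
  simp only [Pi.smul_apply, smul_eq_mul]
  field_simp
  fin_cases i <;> fin_cases j <;> simp <;> grind

theorem exists_eq_smul_cross {x y w : Fin 3 → ℂ} (hxy : x ⨯₃ y ≠ 0) (hx : x ⬝ᵥ w = 0)
    (hy : y ⬝ᵥ w = 0) : ∃ c : ℂ, w = c • (x ⨯₃ y) := by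
  apply exists_eq_smul_of_cross_eq_zero hxy
  ext i
  simp [dotProduct, Fin.sum_univ_three] at hx hy
  fin_cases i <;> simp [cross_apply] <;> grind

theorem exists_eq_add_of_cross_dot_eq_zero {x y w : Fin 3 → ℂ} (hxy : x ⨯₃ y ≠ 0)
    (h : (x ⨯₃ y) ⬝ᵥ w = 0) : ∃ a b : ℂ, w = a • x + b • y := by
  obtain ⟨i, hi⟩ := Function.ne_iff.1 hxy
  simp [cross_apply, dotProduct, Fin.sum_univ_three] at h hi
  fin_cases i <;> simp at hi
  · refine ⟨(w 1 * y 2 - w 2 * y 1) / (x 1 * y 2 - x 2 * y 1),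
      (x 1 * w 2 - x 2 * w 1) / (x 1 * y 2 - x 2 * y 1), ?_⟩
    ext j
    fin_cases j <;> simp <;> field_simp <;> grind
  · refine ⟨(w 2 * y 0 - w 0 * y 2) / (x 2 * y 0 - x 0 * y 2),
      (x 2 * w 0 - x 0 * w 2) / (x 2 * y 0 - x 0 * y 2), ?_⟩
    ext j
    fin_cases j <;> simp <;> field_simp <;> grind
  · refine ⟨(w 0 * y 1 - w 1 * y 0) / (x 0 * y 1 - x 1 * y 0),
      (x 0 * w 1 - x 1 * w 0) / (x 0 * y 1 - x 1 * y 0), ?_⟩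
    ext j
    fin_cases j <;> simp <;> field_simp <;> grind

/-- A matrix of size 3 all of whose minors of size 2 vanish has rank at most one. -/
theorem exists_eq_vecMulVec_of_adjugate_eq_zero {M : Matrix (Fin 3) (Fin 3) ℂ}
    (h : M.adjugate = 0) : ∃ a b : Fin 3 → ℂ, M = vecMulVec a b := by
  by_cases hM : M = 0
  · exact ⟨0, 0, by simp [hM]⟩
  obtain ⟨i, j, hij⟩ : ∃ i j, M i j ≠ 0 := by
    by_contra! hc
    exact hM (Matrix.ext hc)
  refine ⟨fun k => M k j, fun l => M i l / M i j, ?_⟩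
  have e := fun k l => congrFun (congrFun h k) l
  simp [adjugate_fin_three, Fin.forall_fin_succ] at e
  ext k l
  simp only [vecMulVec_apply]
  field_simp
  fin_cases i <;> fin_cases j <;> fin_cases k <;> fin_cases l <;> simp <;> grind

theorem adjugate_adjugate_eq_zero_of_det_eq_zero {M : Matrix (Fin 3) (Fin 3) ℂ}
    (h : M.det = 0) : M.adjugate.adjugate = 0 := by
  rw [adjugate_adjugate M (by simp), h]
  simp

theorem add_adjugate_eq (A : Matrix (Fin 3) (Fin 3) ℂ) :
    A + A.adjugate = (A.trace - 1) • (1 : Matrix (Fin 3) (Fin 3) ℂ) + (A - 1).adjugate := by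
  ext i j
  fin_cases i <;> fin_cases j <;>
    simp [adjugate_fin_three, trace_fin_three] <;> ring

theorem det_sub_one (A : Matrix (Fin 3) (Fin 3) ℂ) :
    (A - 1).det = A.det - A.adjugate.trace + A.trace - 1 := by
  simp [det_fin_three, adjugate_fin_three, trace_fin_three]
  ring

theorem trace_vecMulVec_mul (u w : Fin 3 → ℂ) (X : Matrix (Fin 3) (Fin 3) ℂ) :
    (vecMulVec u w * X).trace = w ⬝ᵥ X *ᵥ u := by
  rw [vecMulVec_mul, trace_vecMulVec, dotProduct_comm, dotProduct_mulVec]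

/-- A matrix in `SL(3, ℂ)` with `tr A⁻¹ = tr A` has the eigenvalue 1; either the symmetric part
`A + A⁻¹` differs from a scalar matrix by a rank one matrix built from a right and a left
eigenvector, or `A` is a transvection or the identity. -/
theorem exists_vecMulVec_of_trace_inv_eq {A : Matrix (Fin 3) (Fin 3) ℂ} (hA : A.det = 1)
    (htr : A⁻¹.trace = A.trace) :
    (∃ u w : Fin 3 → ℂ, u ≠ 0 ∧ w ≠ 0 ∧ A *ᵥ u = u ∧ w ᵥ* A = w ∧
      A + A⁻¹ = (A.trace - 1) • (1 : Matrix (Fin 3) (Fin 3) ℂ) + vecMulVec u w) ∨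
    (∃ a b : Fin 3 → ℂ, A = 1 + vecMulVec a b ∧ A⁻¹ = 1 - vecMulVec a b) := by
  have hinv : A⁻¹ = A.adjugate := by simp [Matrix.inv_def, hA]
  have hdet : (A - 1).det = 0 := by
    rw [det_sub_one, ← hinv, htr, hA]; ring
  have hsum := add_adjugate_eq A
  by_cases h0 : (A - 1).adjugate = 0
  · right
    obtain ⟨a, b, hab⟩ := exists_eq_vecMulVec_of_adjugate_eq_zero h0
    have hAab : A = 1 + vecMulVec a b := by rw [← hab]; abel
    refine ⟨a, b, hAab, ?_⟩
    have htrace : A.trace = 3 := by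
      have := congrArg trace hsum
      rw [← hinv, h0] at this
      simp [htr] at this
      linear_combination -this
    rw [h0, htrace, ← hinv] at hsum
    rw [eq_sub_of_add_eq' hsum, hAab]
    ext i j
    simp
    ring
  · left
    obtain ⟨u, w, huw⟩ := exists_eq_vecMulVec_of_adjugate_eq_zero
      (adjugate_adjugate_eq_zero_of_det_eq_zero hdet)
    have hu : u ≠ 0 := by rintro rfl; exact h0 (by simp [huw])
    have hw : w ≠ 0 := by rintro rfl; exact h0 (by simp [huw])
    refine ⟨u, w, hu, hw, ?_, ?_, by rw [hinv, hsum, huw]⟩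
    · have h1 := mul_adjugate (A - 1)
      rw [hdet, zero_smul, huw, mul_vecMulVec] at h1
      have h2 := (vecMulVec_eq_zero.1 h1).resolve_right hw
      rw [sub_mulVec, one_mulVec] at h2
      exact sub_eq_zero.1 h2
    · have h1 := adjugate_mul (A - 1)
      rw [hdet, zero_smul, huw, vecMulVec_mul] at h1
      have h2 := (vecMulVec_eq_zero.1 h1).resolve_left hu
      rw [vecMul_sub, vecMul_one] at h2
      exact sub_eq_zero.1 h2

/-- The case in which both matrices have a rank one symmetric part up to scalars. -/
theorem hasCommonInvariantSubspace_of_gram {A A' B B' : Matrix (Fin 3) (Fin 3) ℂ} {α β : ℂ}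
    {u w v x : Fin 3 → ℂ} (hu : u ≠ 0) (hw : w ≠ 0) (hv : v ≠ 0) (hx : x ≠ 0)
    (hAu : A *ᵥ u = u) (hA'u : A' *ᵥ u = u) (hwA : w ᵥ* A = w) (hwA' : w ᵥ* A' = w)
    (hBv : B *ᵥ v = v) (hB'v : B' *ᵥ v = v) (hxB : x ᵥ* B = x) (hxB' : x ᵥ* B' = x)
    (hA : A + A' = α • (1 : Matrix (Fin 3) (Fin 3) ℂ) + vecMulVec u w)
    (hB : B + B' = β • (1 : Matrix (Fin 3) (Fin 3) ℂ) + vecMulVec v x)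
    (hD : x ⬝ᵥ (A - A') *ᵥ v = 0) (hE : w ⬝ᵥ (B - B') *ᵥ u = 0)
    (hgram : (u ⬝ᵥ w) * (v ⬝ᵥ x) = (u ⬝ᵥ x) * (v ⬝ᵥ w)) :
    HasCommonInvariantSubspace A B := by
  by_cases hwx : w ⨯₃ x = 0
  · obtain ⟨c, rfl⟩ := exists_eq_smul_of_cross_eq_zero hx hwx
    have hc : c ≠ 0 := by rintro rfl; simp at hw
    refine hasCommonInvariantSubspace_of_vecMul hx (a := 1) (b := 1) ?_ (by simpa using hxB)
    simpa [smul_vecMul, hc] using hwA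
  by_cases huv : u ⨯₃ v = 0
  · obtain ⟨c, rfl⟩ := exists_eq_smul_of_cross_eq_zero hv huv
    have hc : c ≠ 0 := by rintro rfl; simp at hu
    refine hasCommonInvariantSubspace_of_mulVec hv (a := 1) (b := 1) ?_ (by simpa using hBv)
    simpa [mulVec_smul, hc] using hAu
  obtain ⟨c, hc⟩ := exists_eq_smul_cross hwx (w := (A - A') *ᵥ v)
    (by rw [dotProduct_mulVec, vecMul_sub, hwA, hwA']; simp) hD
  obtain ⟨d, hd⟩ := exists_eq_smul_cross hwx (w := (B - B') *ᵥ u) hE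
    (by rw [dotProduct_mulVec, vecMul_sub, hxB, hxB']; simp)
  obtain ⟨a, b, hab⟩ := exists_eq_add_of_cross_dot_eq_zero huv (w := w ⨯₃ x)
    (by rw [cross_dot_cross]; linear_combination hgram)
  have hDu : (A - A') *ᵥ u = 0 := by rw [sub_mulVec, hAu, hA'u, sub_self]
  have hEv : (B - B') *ᵥ v = 0 := by rw [sub_mulVec, hBv, hB'v, sub_self]
  have hwn : w ⬝ᵥ (w ⨯₃ x) = 0 := by simp
  have hxn : x ⬝ᵥ (w ⨯₃ x) = 0 := by simp
  set n := w ⨯₃ x with hn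
  have hDn : (A - A') *ᵥ n = (b * c) • n := by
    conv_lhs => rw [hab]
    rw [mulVec_add, mulVec_smul, mulVec_smul, hDu, hc, smul_zero, zero_add, smul_smul]
  have hEn : (B - B') *ᵥ n = (a * d) • n := by
    conv_lhs => rw [hab]
    rw [mulVec_add, mulVec_smul, mulVec_smul, hEv, hd, smul_zero, add_zero, smul_smul]
  have hSn : (A + A') *ᵥ n = α • n := by
    rw [hA, add_mulVec, vecMulVec_mulVec, hwn]
    simp [smul_mulVec]
  have hTn : (B + B') *ᵥ n = β • n := by
    rw [hB, add_mulVec, vecMulVec_mulVec, hxn]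
    simp [smul_mulVec]
  rw [sub_mulVec] at hDn hEn
  rw [add_mulVec] at hSn hTn
  refine hasCommonInvariantSubspace_of_mulVec hwx (a := (α + b * c) / 2) (b := (β + a * d) / 2)
    ?_ ?_
  · ext i
    have h1 := congrFun hDn i
    have h2 := congrFun hSn i
    simp only [Pi.sub_apply, Pi.add_apply, Pi.smul_apply, smul_eq_mul] at h1 h2 ⊢
    linear_combination (h1 + h2) / 2
  · ext i
    have h1 := congrFun hEn i
    have h2 := congrFun hTn i
    simp only [Pi.sub_apply, Pi.add_apply, Pi.smul_apply, smul_eq_mul] at h1 h2 ⊢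
    linear_combination (h1 + h2) / 2

/-- The case in which one of the two matrices is a transvection. -/
theorem hasCommonInvariantSubspace_of_transvection {A A' B : Matrix (Fin 3) (Fin 3) ℂ}
    {a b v x : Fin 3 → ℂ} (hA : A = 1 + vecMulVec a b) (hA' : A' = 1 - vecMulVec a b)
    (hv : v ≠ 0) (hx : x ≠ 0) (hBv : B *ᵥ v = v) (hxB : x ᵥ* B = x)
    (hD : x ⬝ᵥ (A - A') *ᵥ v = 0) : HasCommonInvariantSubspace A B := by
  have h1 : (x ⬝ᵥ a) * (b ⬝ᵥ v) = 0 := by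
    have e : A - A' = vecMulVec a b + vecMulVec a b := by rw [hA, hA']; abel
    rw [e, add_mulVec, vecMulVec_mulVec] at hD
    simpa [or_comm] using hD
  rcases mul_eq_zero.1 h1 with h | h
  · refine hasCommonInvariantSubspace_of_vecMul hx (a := 1) (b := 1) ?_ (by simpa using hxB)
    rw [hA, vecMul_add, vecMul_vecMulVec, h]
    simp
  · refine hasCommonInvariantSubspace_of_mulVec hv (a := 1) (b := 1) ?_ (by simpa using hBv)
    rw [hA, add_mulVec, vecMulVec_mulVec, h]
    simp

theorem hasCommonInvariantSubspace_one_add_vecMulVec (a b c d : Fin 3 → ℂ) :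
    HasCommonInvariantSubspace (1 + vecMulVec a b) (1 + vecMulVec c d) := by
  obtain ⟨n, hn, hn'⟩ := exists_mulVec_eq_zero_iff.2
    (show (Matrix.of ![b, d, 0]).det = 0 by simp [det_fin_three])
  have hb : b ⬝ᵥ n = 0 := congrFun hn' 0
  have hd : d ⬝ᵥ n = 0 := congrFun hn' 1
  refine hasCommonInvariantSubspace_of_mulVec hn (a := 1) (b := 1) ?_ ?_
  · rw [add_mulVec, vecMulVec_mulVec, hb]; simp
  · rw [add_mulVec, vecMulVec_mulVec, hd]; simp

theorem dotProduct_sub_inv_mulVec_eq_zero {A B : Matrix (Fin 3) (Fin 3) ℂ} {α : ℂ}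
    {u w : Fin 3 → ℂ} (hBtr : B⁻¹.trace = B.trace)
    (hAB : (A * B).trace = (A⁻¹ * B⁻¹).trace) (hAB' : (A⁻¹ * B).trace = (A * B⁻¹).trace)
    (hA : A + A⁻¹ = α • (1 : Matrix (Fin 3) (Fin 3) ℂ) + vecMulVec u w) :
    w ⬝ᵥ (B - B⁻¹) *ᵥ u = 0 := by
  rw [← trace_vecMulVec_mul, ← sub_eq_of_eq_add' hA]
  simp only [sub_mul, add_mul, mul_sub, smul_mul, one_mul, trace_sub, trace_add, trace_smul,
    smul_eq_mul]
  rw [hAB, hAB', hBtr]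
  ring

theorem inv_mulVec_eq {A : Matrix (Fin 3) (Fin 3) ℂ} (hA : A.det = 1) {u : Fin 3 → ℂ}
    (h : A *ᵥ u = u) : A⁻¹ *ᵥ u = u := by
  conv_lhs => rw [← h]
  rw [mulVec_mulVec, nonsing_inv_mul _ (by simp [hA]), one_mulVec]

theorem vecMul_inv_eq {A : Matrix (Fin 3) (Fin 3) ℂ} (hA : A.det = 1) {u : Fin 3 → ℂ}
    (h : u ᵥ* A = u) : u ᵥ* A⁻¹ = u := by
  conv_lhs => rw [← h]
  rw [vecMul_vecMul, mul_nonsing_inv _ (by simp [hA]), vecMul_one]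

theorem reducible_of_shape_invariant_eq
    (A B C : Matrix (Fin 3) (Fin 3) ℂ)
    (hA : A.det = 1) (hB : B.det = 1) (hC : C.det = 1)
    (h : C * B * A = 1)
    (hAtr : (A⁻¹).trace = A.trace)
    (hBtr : (B⁻¹).trace = B.trace)
    (hCtr : (C⁻¹).trace = C.trace)
    (hcomm : ((A * B * A⁻¹ * B⁻¹)⁻¹).trace = (A * B * A⁻¹ * B⁻¹).trace)
    (hσ : (A⁻¹ * B).trace - (A⁻¹).trace * B.trace
        = (B⁻¹ * A).trace - (B⁻¹).trace * A.trace)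
    (hval : (A⁻¹ * B).trace - (A⁻¹).trace * B.trace
        = 3 - A.trace - B.trace - C.trace) :
    ∃ W : Submodule ℂ (Fin 3 → ℂ), W ≠ ⊥ ∧ W ≠ ⊤ ∧
      (∀ v ∈ W, A.mulVec v ∈ W) ∧ (∀ v ∈ W, B.mulVec v ∈ W) := by
  have hCinv : C⁻¹ = B * A := inv_eq_right_inv (by rw [← mul_assoc, h])
  have hCeq : C = A⁻¹ * B⁻¹ := by
    rw [← Matrix.mul_inv_rev, ← hCinv, nonsing_inv_nonsing_inv _ (by simp [hC])]
  have hAB : (A * B).trace = (A⁻¹ * B⁻¹).trace := by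
    rw [trace_mul_comm, ← hCinv, hCtr, ← hCeq]
  have hAB' : (A⁻¹ * B).trace = (A * B⁻¹).trace := by
    rw [trace_mul_comm A, hAtr, hBtr] at *
    linear_combination hσ
  have hBA : (B * A).trace = (B⁻¹ * A⁻¹).trace := by
    rw [trace_mul_comm, hAB, trace_mul_comm]
  have hBA' : (B⁻¹ * A).trace = (B * A⁻¹).trace := by
    rw [trace_mul_comm, ← hAB', trace_mul_comm]
  change HasCommonInvariantSubspace A B
  rcases exists_vecMulVec_of_trace_inv_eq hA hAtr with
    ⟨u, w, hu, hw, hAu, hwA, hS⟩ | ⟨a, b, hab, hab'⟩ <;>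
  rcases exists_vecMulVec_of_trace_inv_eq hB hBtr with
    ⟨v, x, hv, hx, hBv, hxB, hT⟩ | ⟨c, d, hcd, hcd'⟩
  · have hE := dotProduct_sub_inv_mulVec_eq_zero hBtr hAB hAB' hS
    have hD := dotProduct_sub_inv_mulVec_eq_zero hAtr hBA hBA' hT
    refine hasCommonInvariantSubspace_of_gram hu hw hv hx hAu (inv_mulVec_eq hA hAu) hwA
      (vecMul_inv_eq hA hwA) hBv (inv_mulVec_eq hB hBv) hxB (vecMul_inv_eq hB hxB) hS hT hD hE ?_
    have h1 := congrArg trace hS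
    have h2 := congrArg trace hT
    have h3 := trace_vecMulVec_mul u w (vecMulVec v x)
    rw [vecMulVec_mulVec, ← sub_eq_of_eq_add' hS, ← sub_eq_of_eq_add' hT] at h3
    have htrC : C.trace = (A * B).trace := by rw [hAB, hCeq]
    simp only [sub_mul, mul_sub, add_mul, mul_add, smul_mul, Matrix.mul_smul, one_mul, mul_one,
      trace_add, trace_sub, trace_smul, smul_eq_mul, trace_one, Fintype.card_fin, trace_vecMulVec,
      dotProduct_smul, op_smul_eq_smul, ← hAB, ← hAB', hAtr, hBtr] at h1 h2 h3
    rw [hAtr, htrC] at hval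
    rw [dotProduct_comm w v, dotProduct_comm x u] at h3
    push_cast at h1 h2 h3
    have hgu : u ⬝ᵥ w = 3 - A.trace := by linear_combination -h1
    have hgv : v ⬝ᵥ x = 3 - B.trace := by linear_combination -h2
    rw [hgu, hgv]
    linear_combination h3 - 2 * hval
  · exact (hasCommonInvariantSubspace_of_transvection hcd hcd' hu hw hAu hwA
      (dotProduct_sub_inv_mulVec_eq_zero hBtr hAB hAB' hS)).symm
  · exact hasCommonInvariantSubspace_of_transvection hab hab' hv hx hBv hxB
      (dotProduct_sub_inv_mulVec_eq_zero hAtr hBA hBA' hT)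
  · rw [hab, hcd]
    exact hasCommonInvariantSubspace_one_add_vecMulVec a b c d
end

section
/- Let A, B, C be in SL(3,ℂ) with CBA = I such that the pair {A, B} is irreducible. Suppose tr(A) = tr(A⁻¹), tr(B) = tr(B⁻¹), tr(C) = tr(C⁻¹), σ₊(A,B,C) = σ₋(A,B,C) and tr([A,B]) = tr([B,A]). Then there exists an invertible 3×3 complex matrix D such that each of the matrices M = DAD⁻¹, DBD⁻¹, DCD⁻¹ satisfies Mᵀ·J·M = J, where J is the 3×3 matrix with rows (0,0,1), (0,1,0), (1,0,0); that is, the conjugated group lies in the complex orthogonal group SO(J,ℂ) ≅ SO(3,ℂ). -/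
open Matrix

/-- The quadratic form matrix `J`. -/
def Jmat : Matrix (Fin 3) (Fin 3) ℂ :=
  !![0, 0, 1; 0, 1, 0; 1, 0, 0]

section Words
variable {K P : Type*} [Field K] [Ring P] [Algebra K P]

/-- The shape taken by the polarised Cayley–Hamilton relation for a sandwich `x * y * x` in
`3 × 3` matrices when `x` has determinant one and inverse `x'`. -/
def SandwichRel (K : Type*) {P : Type*} [Field K] [Ring P] [Algebra K P] (x x' y : P) : Prop :=
  ∃ s u v w : K, x * y * x = s • y + u • x' + v • x + w • 1 - x' * y - y * x'

/-- The nineteen words in `a`, `b` and their inverses `a'`, `b'` to which all words reduce. -/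
def reducedWords (a a' b b' : P) : Set P :=
  {1, a, a', b, b', a * b, a * b', a' * b, a' * b', b * a, b * a', b' * a, b' * a',
    a * b * a', a * b' * a', b * a * b', b * a' * b', a * b * a' * b', b * a * b' * a'}

theorem reducedWords_swap (a a' b b' : P) : reducedWords b b' a a' = reducedWords a a' b b' := by
  ext z
  simp only [reducedWords, Set.mem_insert_iff, Set.mem_singleton_iff]
  grind

theorem mul_mem_span_reducedWords {a a' b b' : P} (ha : a * a' = 1) (ha' : a' * a = 1)
    (hb : b * b' = 1) (hb' : b' * b = 1) {t s : K} (hsq : a * a = t • a - s • 1 + a')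
    (h₁ : SandwichRel K a a' b) (h₂ : SandwichRel K a a' b')
    (h₃ : SandwichRel K a' a b) (h₄ : SandwichRel K a' a b')
    {z : P} (hz : z ∈ Submodule.span K (reducedWords a a' b b')) :
    a * z ∈ Submodule.span K (reducedWords a a' b b') := by
  set N := Submodule.span K (reducedWords a a' b b') with hN
  have hw : ∀ z ∈ reducedWords a a' b b', z ∈ N := fun z hz => Submodule.subset_span hz
  simp only [reducedWords, Set.mem_insert_iff, Set.mem_singleton_iff, forall_eq_or_imp, forall_eq,
    mul_assoc] at hw
  obtain ⟨w₁, w₂, w₃, w₄, w₅, w₆, w₇, w₈, w₉, w₁₀, w₁₁, w₁₂, w₁₃, w₁₄, w₁₅, w₁₆, w₁₇, w₁₈,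
    w₁₉⟩ := hw
  have ca (z : P) : a * (a' * z) = z := by rw [← mul_assoc, ha, one_mul]
  have ca' (z : P) : a' * (a * z) = z := by rw [← mul_assoc, ha', one_mul]
  have cb (z : P) : b * (b' * z) = z := by rw [← mul_assoc, hb, one_mul]
  have cb' (z : P) : b' * (b * z) = z := by rw [← mul_assoc, hb', one_mul]
  have csq (z : P) : a * (a * z) = t • (a * z) - s • z + a' * z := by
    rw [← mul_assoc, hsq]; simp [add_mul, sub_mul]
  obtain ⟨s₁, u₁, v₁, x₁, h₁⟩ := h₁
  obtain ⟨s₂, u₂, v₂, x₂, h₂⟩ := h₂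
  obtain ⟨s₃, u₃, v₃, x₃, h₃⟩ := h₃
  obtain ⟨s₄, u₄, v₄, x₄, h₄⟩ := h₄
  have k₁ (z : P) := congrArg (· * z) h₁
  have k₃ (z : P) := congrArg (· * z) h₃
  rw [mul_assoc] at h₁ h₂ h₃ h₄
  simp only [add_mul, sub_mul, smul_mul_assoc, one_mul, mul_assoc] at k₁ k₃
  have hsq' : a' * a' = a - t • 1 + s • a' := by
    have h := congrArg (a' * ·) hsq
    simp only [ca', ha', mul_add, mul_sub, mul_smul_comm, mul_one] at h
    rw [h]; abel
  suffices h : N ≤ N.comap (LinearMap.mulLeft K a) from h hz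
  rw [hN, Submodule.span_le]
  intro z hz
  rw [← hN]
  simp only [SetLike.mem_coe, Submodule.mem_comap, LinearMap.mulLeft_apply]
  simp only [reducedWords, Set.mem_insert_iff, Set.mem_singleton_iff] at hz
  rcases hz with rfl | rfl | rfl | rfl | rfl | rfl | rfl | rfl | rfl | rfl | rfl | rfl | rfl | rfl |
    rfl | rfl | rfl | rfl | rfl <;>
  (try simp only [mul_assoc, ca, cb, csq, ha, hb, h₁, h₂, h₃, h₄, k₁, k₃, hsq, hsq', mul_one,
    mul_add, mul_sub, mul_smul_comm, smul_add, smul_sub]) <;>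
  repeat' first
    | with_reducible assumption
    | apply N.add_mem
    | apply N.sub_mem
    | apply N.smul_mem

theorem adjoin_le_span_reducedWords {a a' b b' : P} (ha : a * a' = 1) (ha' : a' * a = 1)
    (hb : b * b' = 1) (hb' : b' * b = 1) {t s t' s' : K} (hsqa : a * a = t • a - s • 1 + a')
    (hsqb : b * b = t' • b - s' • 1 + b')
    (h₁ : SandwichRel K a a' b) (h₂ : SandwichRel K a a' b')
    (h₃ : SandwichRel K a' a b) (h₄ : SandwichRel K a' a b')
    (h₅ : SandwichRel K b b' a) (h₆ : SandwichRel K b b' a')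
    (h₇ : SandwichRel K b' b a) (h₈ : SandwichRel K b' b a') :
    (Algebra.adjoin K {a, b}).toSubmodule ≤ Submodule.span K (reducedWords a a' b b') := by
  intro z hz
  suffices h : ∀ y ∈ Submodule.span K (reducedWords a a' b b'),
      z * y ∈ Submodule.span K (reducedWords a a' b b') by
    simpa using h 1 (Submodule.subset_span (by simp [reducedWords]))
  induction hz using Algebra.adjoin_induction with
  | mem x hx =>
    intro y hy
    rcases hx with rfl | rfl
    · exact mul_mem_span_reducedWords ha ha' hb hb' hsqa h₁ h₂ h₃ h₄ hy
    · rw [← reducedWords_swap] at hy ⊢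
      exact mul_mem_span_reducedWords hb hb' ha ha' hsqb h₅ h₆ h₇ h₈ hy
  | algebraMap r =>
    intro y hy
    rw [← Algebra.smul_def]
    exact Submodule.smul_mem _ _ hy
  | add x y _ _ hx hy =>
    intro w hw
    rw [add_mul]
    exact add_mem (hx w hw) (hy w hw)
  | mul x y _ _ hx hy =>
    intro w hw
    rw [mul_assoc]
    exact hx _ (hy w hw)

end Words

/-- The polarised Cayley–Hamilton identity for `3 × 3` matrices. -/
theorem cayley_sandwich {R : Type*} [CommRing R] (X Y : Matrix (Fin 3) (Fin 3) R) :
    X * Y * X = X.adjugate.trace • Y + Y.trace • X.adjugate + (X * Y).trace • X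
      + ((X.adjugate * Y).trace - X.adjugate.trace * Y.trace) • (1 : Matrix (Fin 3) (Fin 3) R)
      - X.adjugate * Y - Y * X.adjugate := by
  ext i j
  fin_cases i <;> fin_cases j <;>
  simp [adjugate_fin_three, mul_apply, trace_fin_three, Fin.sum_univ_three,
    vecMul, dotProduct] <;> ring

theorem sq_eq_adjugate {R : Type*} [CommRing R] (X : Matrix (Fin 3) (Fin 3) R) :
    X * X = X.trace • X - X.adjugate.trace • (1 : Matrix (Fin 3) (Fin 3) R) + X.adjugate := by
  ext i j
  fin_cases i <;> fin_cases j <;>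
  simp [adjugate_fin_three, mul_apply, trace_fin_three, Fin.sum_univ_three] <;> ring

/-- **Burnside's theorem** on irreducible algebras of linear maps. -/
theorem Subalgebra.eq_top_of_invariant_submodules {K V : Type*} [Field K] [IsAlgClosed K]
    [AddCommGroup V] [Module K V] [FiniteDimensional K V] [Nontrivial V]
    (S : Subalgebra K (Module.End K V))
    (hS : ∀ W : Submodule K V, (∀ f ∈ S, ∀ v ∈ W, f v ∈ W) → W = ⊥ ∨ W = ⊤) : S = ⊤ := by
  have : IsSimpleModule S V := by
    rw [isSimpleModule_iff]
    refine { exists_pair_ne := ⟨⊥, ⊤, bot_ne_top⟩, eq_bot_or_eq_top := fun W => ?_ }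
    refine (hS (W.restrictScalars K) fun f hf v hv => W.smul_mem (⟨f, hf⟩ : S) hv).imp ?_ ?_ <;>
    simp
  have hsc := (IsSimpleModule.algebraMap_end_bijective_of_isAlgClosed (A := S) (V := V) K).2
  rw [eq_top_iff]
  intro g _
  let g' : Module.End (Module.End S V) V :=
    { toFun := g
      map_add' := g.map_add
      map_smul' := fun c v => by
        obtain ⟨r, rfl⟩ := hsc c
        simp }
  classical
  obtain ⟨r, hr⟩ := jacobson_density (R := S) g' (Finset.univ.image (Module.finBasis K V))
  have : g = r := (Module.finBasis K V).ext fun i => hr _ (by simp)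
  exact this ▸ r.2

theorem IsIrreduciblePair.adjoin_eq_top {A B : Matrix (Fin 3) (Fin 3) ℂ}
    (h : IsIrreduciblePair A B) : Algebra.adjoin ℂ {A, B} = ⊤ := by
  have key : (Algebra.adjoin ℂ {A, B}).map
      (Matrix.toLinAlgEquiv' (R := ℂ) (n := Fin 3)).toAlgHom = ⊤ :=
    Subalgebra.eq_top_of_invariant_submodules _ fun W hW => h W
      (fun v hv => hW _ ⟨A, Algebra.subset_adjoin (by simp), rfl⟩ v hv)
      (fun v hv => hW _ ⟨B, Algebra.subset_adjoin (by simp), rfl⟩ v hv)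
  rw [eq_top_iff]
  intro X _
  have : Matrix.toLinAlgEquiv' X ∈ (⊤ : Subalgebra ℂ (Module.End ℂ (Fin 3 → ℂ))) := trivial
  rw [← key] at this
  obtain ⟨Y, hY, hYX⟩ := this
  rwa [← Matrix.toLinAlgEquiv'.injective hYX]

/-- Automorphisms of a matrix algebra over a field are inner. -/
theorem Matrix.algEquiv_exists_conj {K n : Type*} [Field K] [Fintype n] [DecidableEq n]
    (φ : Matrix n n K ≃ₐ[K] Matrix n n K) :
    ∃ S : Matrix n n K, IsUnit S ∧ ∀ X, φ X * S = S * X := by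
  obtain ⟨T, hT⟩ := AlgEquiv.eq_linearEquivConjAlgEquiv
    ((Matrix.toLinAlgEquiv'.symm.trans φ).trans Matrix.toLinAlgEquiv')
  refine ⟨LinearMap.toMatrix' T.toLinearMap, ?_, fun X => ?_⟩
  · rw [Matrix.isUnit_iff_isUnit_det]
    refine IsUnit.of_mul_eq_one (LinearMap.toMatrix' T.symm.toLinearMap).det ?_
    rw [← det_mul, ← LinearMap.toMatrix'_comp]
    simp
  · have := congrArg (fun f => LinearMap.toMatrix' (f ∘ₗ T.toLinearMap))
      (AlgEquiv.congr_fun hT (Matrix.toLinAlgEquiv' X))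
    have h : (T.conjAlgEquiv K (Matrix.toLinAlgEquiv' X)) ∘ₗ T.toLinearMap
        = T.toLinearMap ∘ₗ Matrix.toLin' X := by
      ext; simp [Matrix.toLinAlgEquiv'_apply]
    simp only [h] at this
    have e : LinearMap.toMatrix' (Matrix.toLinAlgEquiv' (φ X)) = φ X :=
      LinearMap.toMatrix'_toLin' _
    simpa [LinearMap.toMatrix'_comp, e] using this

/-- Over an algebraically closed field of characteristic not two, any two nondegenerate symmetric
matrices are congruent. -/
theorem Matrix.IsSymm.exists_congr {K n : Type*} [Field K] [IsAlgClosed K] [Invertible (2 : K)]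
    [Fintype n] [DecidableEq n] {S T : Matrix n n K} (hS : S.IsSymm) (hT : T.IsSymm)
    (hSu : IsUnit S.det) (hTu : IsUnit T.det) : ∃ D : Matrix n n K, IsUnit D ∧ Dᵀ * T * D = S := by
  have assoc {S : Matrix n n K} (hS : S.IsSymm) :
      QuadraticMap.associated S.toQuadraticForm' = Matrix.toLinearMap₂' K S :=
    QuadraticMap.associated_left_inverse' K <| by
      ext i j
      simpa [Matrix.toLinearMap₂'_apply'] using hS.apply i j
  have sep {S : Matrix n n K} (hS : S.IsSymm) (hu : IsUnit S.det) :
      (QuadraticMap.associated (R := K) S.toQuadraticForm').SeparatingLeft := by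
    rw [assoc hS, Matrix.separatingLeft_toLinearMap₂'_iff, Matrix.separatingLeft_iff_det_ne_zero]
    exact hu.ne_zero
  obtain ⟨e⟩ := QuadraticForm.equivalent_of_isAlgClosed _ _ (sep hS hSu) (sep hT hTu)
  have h : S.toQuadraticForm' = T.toQuadraticForm'.comp e.toLinearEquiv.toLinearMap := by
    ext x
    simp
  have h2 := congrArg QuadraticForm.toMatrix' h
  rw [QuadraticForm.toMatrix'_comp] at h2
  simp only [QuadraticForm.toMatrix', assoc hS, assoc hT, LinearMap.toMatrix'_toLinearMap₂'] at h2
  refine ⟨LinearMap.toMatrix' e.toLinearEquiv.toLinearMap, ?_, h2.symm⟩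
  rw [Matrix.isUnit_iff_isUnit_det]
  apply_fun Matrix.det at h2
  simp only [det_mul] at h2
  rw [h2] at hSu
  exact isUnit_of_mul_isUnit_right hSu

theorem Subalgebra.mem_range_scalar_of_commute {K n : Type*} [Field K] [Fintype n] [DecidableEq n]
    {s : Set (Matrix n n K)} (hs : Algebra.adjoin K s = ⊤) {Z : Matrix n n K}
    (hZ : ∀ X ∈ s, Commute X Z) : Z ∈ Set.range (Matrix.scalar n) := by
  have h : Algebra.adjoin K s ≤ Subalgebra.centralizer K {Z} :=
    Algebra.adjoin_le fun X hX => by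
      rw [SetLike.mem_coe, Subalgebra.mem_centralizer_iff]
      rintro _ rfl
      exact (hZ X hX).eq.symm
  refine Matrix.mem_range_scalar_of_commute_single fun i j _ => ?_
  have : Matrix.single i j (1 : K) ∈ Subalgebra.centralizer K {Z} := h (hs ▸ trivial)
  exact (Subalgebra.mem_centralizer_iff K |>.1 this Z rfl).symm

/-- If every element of a subalgebra of a product of matrix algebras has components of equal trace
and the first projection is onto, then the subalgebra is the graph of an inner automorphism. -/
theorem Subalgebra.exists_conj_of_trace_eq {K n : Type*} [Field K] [Fintype n] [DecidableEq n]
    (S : Subalgebra K (Matrix n n K × Matrix n n K))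
    (htr : ∀ z ∈ S, z.1.trace = z.2.trace) (hsurj : ∀ X, ∃ z ∈ S, z.1 = X) :
    ∃ T : Matrix n n K, IsUnit T ∧ ∀ z ∈ S, z.2 * T = T * z.1 := by
  let p : S →ₐ[K] Matrix n n K := (AlgHom.fst K _ _).comp S.val
  let q : S →ₐ[K] Matrix n n K := (AlgHom.snd K _ _).comp S.val
  have hp : Function.Surjective p := fun X => by
    obtain ⟨z, hz, rfl⟩ := hsurj X
    exact ⟨⟨z, hz⟩, rfl⟩
  have hq : Function.Injective q := by
    rw [injective_iff_map_eq_zero]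
    rintro ⟨z, hz⟩ hz2
    replace hz2 : z.2 = 0 := hz2
    have hz1 : z.1 = 0 := by
      rw [Matrix.ext_iff_trace_mul_right]
      intro X
      obtain ⟨w, hw, rfl⟩ := hsurj X
      simpa [hz2] using htr _ (S.mul_mem hz hw)
    exact Subtype.ext (Prod.ext hz1 hz2)
  have hdim : Module.finrank K S = Module.finrank K (Matrix n n K) :=
    (LinearMap.finrank_le_finrank_of_injective (f := q.toLinearMap) hq).antisymm
      (LinearMap.finrank_le_finrank_of_surjective (f := p.toLinearMap) hp)
  have hp' : Function.Injective p :=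
    (LinearMap.injective_iff_surjective_of_finrank_eq_finrank hdim (f := p.toLinearMap)).2 hp
  have hq' : Function.Surjective q :=
    (LinearMap.injective_iff_surjective_of_finrank_eq_finrank hdim (f := q.toLinearMap)).1 hq
  let e := AlgEquiv.ofBijective p ⟨hp', hp⟩
  obtain ⟨T, hT, h⟩ := Matrix.algEquiv_exists_conj
    (e.symm.trans (AlgEquiv.ofBijective q ⟨hq, hq'⟩))
  refine ⟨T, hT, fun z hz => ?_⟩
  have he : e.symm z.1 = ⟨z, hz⟩ := by
    rw [AlgEquiv.symm_apply_eq]; rfl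
  simpa [he] using! h z.1

namespace Matrix.SpecialLinearGroup

/-- A matrix of determinant one paired with its contragredient. -/
def dualPair {n R : Type*} [Fintype n] [DecidableEq n] [CommRing R] :
    SpecialLinearGroup n R →* Matrix n n R × Matrix n n R where
  toFun g := (↑g, (↑g⁻¹ : Matrix n n R)ᵀ)
  map_one' := by simp [Prod.ext_iff]
  map_mul' g h := by
    rw [_root_.mul_inv_rev]
    simp only [coe_mul, transpose_mul, Prod.mk_mul_mk]

theorem dualPair_snd {n R : Type*} [Fintype n] [DecidableEq n] [CommRing R]
    (g : SpecialLinearGroup n R) : (dualPair g).2 = (↑g⁻¹ : Matrix n n R)ᵀ :=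
  rfl

/-- The trace does not distinguish `g` from its inverse. -/
def TraceSymm {n R : Type*} [Fintype n] [DecidableEq n] [CommRing R]
    (g : SpecialLinearGroup n R) : Prop :=
  (g : Matrix n n R).trace = (↑g⁻¹ : Matrix n n R).trace

section TraceSymm
variable {n R : Type*} [Fintype n] [DecidableEq n] [CommRing R] {g h : SpecialLinearGroup n R}

theorem TraceSymm.inv (hg : TraceSymm g) : TraceSymm g⁻¹ := by
  rw [TraceSymm, inv_inv]
  exact Eq.symm hg

theorem TraceSymm.mul_comm (hg : TraceSymm (g * h)) : TraceSymm (h * g) := by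
  rw [TraceSymm, _root_.mul_inv_rev, coe_mul, coe_mul] at *
  rw [trace_mul_comm, hg, trace_mul_comm]

theorem TraceSymm.conj (hg : TraceSymm g) (h : SpecialLinearGroup n R) :
    TraceSymm (h * g * h⁻¹) := by
  rw [mul_assoc]
  exact TraceSymm.mul_comm (by simpa using hg)

end TraceSymm

theorem sandwichRel_dualPair {K : Type*} [Field K] {X Y : SpecialLinearGroup (Fin 3) K}
    (hX : TraceSymm X) (hY : TraceSymm Y) (hXY : TraceSymm (X * Y)) (hXY' : TraceSymm (X⁻¹ * Y)) :
    SandwichRel K (dualPair X) (dualPair X⁻¹) (dualPair Y) := by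
  rw [TraceSymm] at *
  refine ⟨(↑X⁻¹ : Matrix (Fin 3) (Fin 3) K).trace, (Y : Matrix (Fin 3) (Fin 3) K).trace,
    (↑(X * Y) : Matrix (Fin 3) (Fin 3) K).trace, (↑(X⁻¹ * Y) : Matrix (Fin 3) (Fin 3) K).trace
      - (↑X⁻¹ : Matrix (Fin 3) (Fin 3) K).trace * (Y : Matrix (Fin 3) (Fin 3) K).trace,
    Prod.ext ?_ ?_⟩
  · have h := cayley_sandwich (X : Matrix (Fin 3) (Fin 3) K) (Y : Matrix (Fin 3) (Fin 3) K)
    rw [← coe_inv] at h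
    simpa only [coe_mul] using! h
  · have h := cayley_sandwich (↑X⁻¹ : Matrix (Fin 3) (Fin 3) K)ᵀ (↑Y⁻¹ : Matrix (Fin 3) (Fin 3) K)ᵀ
    have ht (P Q : Matrix (Fin 3) (Fin 3) K) : (Pᵀ * Qᵀ).trace = (Q * P).trace := by
      rw [← transpose_mul, trace_transpose]
    rw [← adjugate_transpose, ← coe_inv, inv_inv, ht, ht, trace_transpose, trace_transpose] at h
    rw [← hX, hY, hXY, hXY']
    simp only [_root_.mul_inv_rev, inv_inv, coe_mul, Prod.snd_mul, Prod.snd_add, Prod.snd_sub,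
      Prod.smul_snd, Prod.snd_one, dualPair_snd]
    exact h

theorem dualPair_mul_self {K : Type*} [Field K] {X : SpecialLinearGroup (Fin 3) K}
    (hX : TraceSymm X) :
    dualPair X * dualPair X = (X : Matrix (Fin 3) (Fin 3) K).trace • dualPair X
      - (X : Matrix (Fin 3) (Fin 3) K).trace • 1 + dualPair X⁻¹ := by
  rw [TraceSymm] at hX
  refine Prod.ext ?_ ?_
  · have h := sq_eq_adjugate (X : Matrix (Fin 3) (Fin 3) K)
    rw [← coe_inv, ← hX] at h
    exact h
  · have h := sq_eq_adjugate (↑X⁻¹ : Matrix (Fin 3) (Fin 3) K)ᵀ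
    rw [← adjugate_transpose, ← coe_inv, inv_inv, trace_transpose, trace_transpose, ← hX] at h
    simp only [Prod.snd_mul, Prod.snd_add, Prod.snd_sub, Prod.smul_snd, Prod.snd_one, dualPair_snd,
      inv_inv]
    exact h

theorem trace_eq_of_mem_adjoin_dualPair {K : Type*} [Field K] {A B : SpecialLinearGroup (Fin 3) K}
    (hA : TraceSymm A) (hB : TraceSymm B) (hAB : TraceSymm (A * B)) (hAB' : TraceSymm (A⁻¹ * B))
    (hc : TraceSymm (A * B * A⁻¹ * B⁻¹)) :
    ∀ z ∈ Algebra.adjoin K {dualPair A, dualPair B}, z.1.trace = z.2.trace := by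
  have hAiBi : TraceSymm (A⁻¹ * B⁻¹) := by simpa using hAB.mul_comm.inv
  have hABi : TraceSymm (A * B⁻¹) :=
    TraceSymm.mul_comm (by simpa using hAB'.inv)
  have hu (g : SpecialLinearGroup (Fin 3) K) : dualPair g * dualPair g⁻¹ = 1 := by
    rw [← map_mul]; simp
  have hu' (g : SpecialLinearGroup (Fin 3) K) : dualPair g⁻¹ * dualPair g = 1 := by
    rw [← map_mul]; simp
  have hle := adjoin_le_span_reducedWords (hu A) (hu' A) (hu B) (hu' B) (dualPair_mul_self hA)
    (dualPair_mul_self hB) (sandwichRel_dualPair hA hB hAB hAB')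
    (sandwichRel_dualPair hA hB.inv hABi hAiBi)
    (by simpa using sandwichRel_dualPair hA.inv hB hAB' (by simpa using hAB))
    (by simpa using sandwichRel_dualPair hA.inv hB.inv hAiBi (by simpa using hABi))
    (sandwichRel_dualPair hB hA hAB.mul_comm hABi.mul_comm)
    (sandwichRel_dualPair hB hA.inv hAB'.mul_comm hAiBi.mul_comm)
    (by simpa using sandwichRel_dualPair hB.inv hA hABi.mul_comm (by simpa using hAB.mul_comm))
    (by
      simpa using sandwichRel_dualPair hB.inv hA.inv hAiBi.mul_comm
        (by simpa using hAB'.mul_comm))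
  have htr {g : SpecialLinearGroup (Fin 3) K} (hg : TraceSymm g) :
      dualPair g ∈ LinearMap.eqLocus (traceLinearMap (Fin 3) K K ∘ₗ LinearMap.fst K _ _)
        (traceLinearMap (Fin 3) K K ∘ₗ LinearMap.snd K _ _) := by
    simpa [dualPair, TraceSymm] using hg
  suffices h : Submodule.span K (reducedWords (dualPair A) (dualPair A⁻¹) (dualPair B)
      (dualPair B⁻¹)) ≤ LinearMap.eqLocus (traceLinearMap (Fin 3) K K ∘ₗ LinearMap.fst K _ _)
        (traceLinearMap (Fin 3) K K ∘ₗ LinearMap.snd K _ _) from fun z hz => h (hle hz)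
  rw [Submodule.span_le]
  intro z hz
  simp only [reducedWords, Set.mem_insert_iff, Set.mem_singleton_iff, ← map_mul,
    ← map_one (dualPair (n := Fin 3) (R := K))] at hz
  rcases hz with rfl | rfl | rfl | rfl | rfl | rfl | rfl | rfl | rfl | rfl | rfl | rfl | rfl | rfl |
    rfl | rfl | rfl | rfl | rfl
  exacts [htr (by simp [TraceSymm]), htr hA, htr hA.inv, htr hB, htr hB.inv, htr hAB, htr hABi,
    htr hAB', htr hAiBi, htr hAB.mul_comm, htr hAB'.mul_comm, htr hABi.mul_comm,
    htr hAiBi.mul_comm, htr (hB.conj A), htr (hB.inv.conj A), htr (hA.conj B), htr (hA.inv.conj B),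
    htr hc, htr (by simpa [mul_assoc] using hc.inv)]

end Matrix.SpecialLinearGroup

/-- In odd dimension an irreducible set of matrices preserving a nondegenerate bilinear form
preserves it symmetrically. -/
theorem Matrix.isSymm_of_adjoin_eq_top {K n : Type*} [Field K] [Fintype n] [DecidableEq n]
    (hn : Odd (Fintype.card n)) {s : Set (Matrix n n K)} (hs : Algebra.adjoin K s = ⊤)
    {S : Matrix n n K} (hS : IsUnit S) (h : ∀ X ∈ s, Xᵀ * S * X = S) : S.IsSymm := by
  have hdet := (Matrix.isUnit_iff_isUnit_det S).1 hS
  have hZ : S⁻¹ * Sᵀ ∈ Set.range (Matrix.scalar n) := by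
    refine Subalgebra.mem_range_scalar_of_commute hs fun X hX => ?_
    have h1 := h X hX
    have h2 : Xᵀ * Sᵀ * X = Sᵀ := by
      simpa [transpose_mul, mul_assoc] using congrArg transpose h1
    have h3 : S⁻¹ * Xᵀ * S * X = 1 := by
      rw [mul_assoc, mul_assoc, ← mul_assoc Xᵀ, h1, nonsing_inv_mul _ hdet]
    have h4 : X * (S⁻¹ * Xᵀ * S) = 1 := mul_eq_one_comm.1 h3
    calc X * (S⁻¹ * Sᵀ) = X * (S⁻¹ * (Xᵀ * Sᵀ * X)) := by rw [h2]
      _ = X * (S⁻¹ * Xᵀ * (S * S⁻¹)) * Sᵀ * X := by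
        rw [mul_nonsing_inv _ hdet]; simp only [mul_assoc, mul_one]
      _ = (X * (S⁻¹ * Xᵀ * S)) * (S⁻¹ * Sᵀ * X) := by simp only [mul_assoc]
      _ = S⁻¹ * Sᵀ * X := by rw [h4, one_mul]
  obtain ⟨c, hc⟩ := hZ
  have hc' : S⁻¹ * Sᵀ = c • 1 := by rw [← hc, Matrix.scalar_apply, Matrix.smul_one_eq_diagonal]
  have hT : Sᵀ = c • S := by
    have := congrArg (S * ·) hc'
    simpa [← mul_assoc, mul_nonsing_inv _ hdet] using this
  have hc1 : c ^ Fintype.card n = 1 := by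
    have := congrArg det hT
    rw [det_transpose, det_smul] at this
    exact mul_right_cancel₀ hdet.ne_zero (by rw [← this, one_mul])
  have hc2 : c ^ 2 = 1 := by
    have : Nonempty n := Fintype.card_pos_iff.1 hn.pos
    have h1 := congrArg transpose hT
    rw [transpose_transpose, transpose_smul, hT, smul_smul, ← pow_two] at h1
    refine smul_left_injective K hS.ne_zero (?_ : c ^ 2 • S = (1 : K) • S)
    rw [← h1, one_smul]
  obtain ⟨k, hk⟩ := hn
  rw [hk, pow_succ, pow_mul, hc2, one_pow, one_mul] at hc1
  rw [IsSymm, hT, hc1, one_smul]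

/-- Conjugation by a change of basis carries isometries of a form to isometries of the transported
form. -/
theorem Matrix.isometry_conj {K n : Type*} [Field K] [Fintype n] [DecidableEq n]
    {S T D M : Matrix n n K} (hD : IsUnit D) (hS : Dᵀ * T * D = S) (hM : Mᵀ * S * M = S) :
    (D * M * D⁻¹)ᵀ * T * (D * M * D⁻¹) = T := by
  have hdet := (Matrix.isUnit_iff_isUnit_det D).1 hD
  have h1 : D⁻¹ᵀ * Dᵀ = 1 := by rw [← transpose_mul, mul_nonsing_inv _ hdet, transpose_one]
  calc (D * M * D⁻¹)ᵀ * T * (D * M * D⁻¹) = D⁻¹ᵀ * (Mᵀ * (Dᵀ * T * D) * M) * D⁻¹ := by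
        simp only [transpose_mul, mul_assoc]
    _ = (D⁻¹ᵀ * Dᵀ) * T * (D * D⁻¹) := by rw [hS, hM, ← hS]; simp only [mul_assoc]
    _ = T := by rw [h1, mul_nonsing_inv _ hdet, one_mul, mul_one]

/-- An irreducible pair with symmetric trace data preserves a nondegenerate symmetric form. -/
theorem Matrix.SpecialLinearGroup.exists_isSymm_form {K : Type*} [Field K]
    {A B : SpecialLinearGroup (Fin 3) K} (hirr : Algebra.adjoin K {(A : Matrix (Fin 3) (Fin 3) K),
      (B : Matrix (Fin 3) (Fin 3) K)} = ⊤)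
    (hA : TraceSymm A) (hB : TraceSymm B) (hAB : TraceSymm (A * B)) (hAB' : TraceSymm (A⁻¹ * B))
    (hc : TraceSymm (A * B * A⁻¹ * B⁻¹)) :
    ∃ S : Matrix (Fin 3) (Fin 3) K, IsUnit S ∧ S.IsSymm ∧
      (A : Matrix (Fin 3) (Fin 3) K)ᵀ * S * A = S ∧
      (B : Matrix (Fin 3) (Fin 3) K)ᵀ * S * B = S := by
  obtain ⟨S, hS, hconj⟩ := Subalgebra.exists_conj_of_trace_eq _
    (trace_eq_of_mem_adjoin_dualPair hA hB hAB hAB' hc) fun X => by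
      have hX : X ∈ (Algebra.adjoin K {dualPair A, dualPair B}).map (AlgHom.fst K _ _) := by
        rw [AlgHom.map_adjoin, Set.image_pair]
        exact hirr ▸ Algebra.mem_top
      exact hX
  have hpres (g : SpecialLinearGroup (Fin 3) K)
      (hg : dualPair g ∈ Algebra.adjoin K {dualPair A, dualPair B}) :
      (g : Matrix (Fin 3) (Fin 3) K)ᵀ * S * g = S := by
    have h1 : (↑g⁻¹ : Matrix (Fin 3) (Fin 3) K)ᵀ * S = S * g := hconj _ hg
    rw [mul_assoc, ← h1, ← mul_assoc, ← transpose_mul, ← coe_mul, inv_mul_cancel, coe_one,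
      transpose_one, one_mul]
  have hSA := hpres A (Algebra.subset_adjoin (by simp))
  have hSB := hpres B (Algebra.subset_adjoin (by simp))
  exact ⟨S, hS, isSymm_of_adjoin_eq_top (by decide) hirr hS (by simp [hSA, hSB]), hSA, hSB⟩

theorem pants_group_into_SO3C
    (A B C : Matrix (Fin 3) (Fin 3) ℂ)
    (hA : A.det = 1) (hB : B.det = 1) (hC : C.det = 1)
    (h : C * B * A = 1)
    (hirr : IsIrreduciblePair A B)
    (hAtr : A.trace = (A⁻¹).trace)
    (hBtr : B.trace = (B⁻¹).trace)
    (hCtr : C.trace = (C⁻¹).trace)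
    (hσ : (A⁻¹ * B).trace - (A⁻¹).trace * B.trace
        = (B⁻¹ * A).trace - (B⁻¹).trace * A.trace)
    (hcomm : (A * B * A⁻¹ * B⁻¹).trace = (B * A * B⁻¹ * A⁻¹).trace) :
    ∃ D : Matrix (Fin 3) (Fin 3) ℂ, IsUnit D ∧
      (D * A * D⁻¹)ᵀ * Jmat * (D * A * D⁻¹) = Jmat ∧
      (D * B * D⁻¹)ᵀ * Jmat * (D * B * D⁻¹) = Jmat ∧
      (D * C * D⁻¹)ᵀ * Jmat * (D * C * D⁻¹) = Jmat := by
  have hinv (g : SpecialLinearGroup (Fin 3) ℂ) :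
      (↑g⁻¹ : Matrix (Fin 3) (Fin 3) ℂ) = (g : Matrix (Fin 3) (Fin 3) ℂ)⁻¹ := by
    rw [Matrix.SpecialLinearGroup.coe_inv, inv_def, g.det_coe, Ring.inverse_one, one_smul]
  have hCBA : C⁻¹ = B * A := inv_eq_right_inv (by rw [← mul_assoc, h])
  have hBAC : B * A * C = 1 := mul_eq_one_comm.1 (by rw [← mul_assoc, h])
  let a : SpecialLinearGroup (Fin 3) ℂ := ⟨A, hA⟩
  let b : SpecialLinearGroup (Fin 3) ℂ := ⟨B, hB⟩
  have hba : (b * a).TraceSymm := by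
    rw [Matrix.SpecialLinearGroup.TraceSymm, hinv, Matrix.SpecialLinearGroup.coe_mul]
    change (B * A).trace = (B * A)⁻¹.trace
    rw [inv_eq_right_inv hBAC, ← hCBA, hCtr]
  have hab' : (a⁻¹ * b).TraceSymm := by
    rw [Matrix.SpecialLinearGroup.TraceSymm, _root_.mul_inv_rev, inv_inv,
      Matrix.SpecialLinearGroup.coe_mul, Matrix.SpecialLinearGroup.coe_mul, hinv, hinv]
    change (A⁻¹ * B).trace = (B⁻¹ * A).trace
    linear_combination hσ - B.trace * hAtr + A.trace * hBtr
  have hc : (a * b * a⁻¹ * b⁻¹).TraceSymm := by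
    rw [Matrix.SpecialLinearGroup.TraceSymm,
      show (a * b * a⁻¹ * b⁻¹)⁻¹ = b * a * b⁻¹ * a⁻¹ by group]
    simp only [Matrix.SpecialLinearGroup.coe_mul, hinv]
    exact hcomm
  obtain ⟨S, hS, hSymm, hSA, hSB⟩ := Matrix.SpecialLinearGroup.exists_isSymm_form (A := a) (B := b)
    hirr.adjoin_eq_top (by rw [Matrix.SpecialLinearGroup.TraceSymm, hinv]; exact hAtr)
    (by rw [Matrix.SpecialLinearGroup.TraceSymm, hinv]; exact hBtr) hba.mul_comm hab' hc
  change Aᵀ * S * A = S at hSA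
  change Bᵀ * S * B = S at hSB
  have hSC : Cᵀ * S * C = S := by
    have hSBA : (B * A)ᵀ * S * (B * A) = S := by
      calc (B * A)ᵀ * S * (B * A) = Aᵀ * (Bᵀ * S * B) * A := by
            simp only [transpose_mul, mul_assoc]
        _ = S := by rw [hSB, hSA]
    calc Cᵀ * S * C = Cᵀ * ((B * A)ᵀ * S * (B * A)) * C := by rw [hSBA]
      _ = (B * A * C)ᵀ * S * (B * A * C) := by simp only [transpose_mul, mul_assoc]
      _ = S := by rw [hBAC, transpose_one, one_mul, mul_one]
  have hJ : Jmat.IsSymm := by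
    ext i j
    fin_cases i <;> fin_cases j <;> rfl
  have : Invertible (2 : ℂ) := invertibleOfNonzero two_ne_zero
  obtain ⟨D, hD, hDS⟩ := hSymm.exists_congr hJ ((isUnit_iff_isUnit_det S).1 hS)
    (by simp [Jmat, det_fin_three])
  exact ⟨D, hD, isometry_conj hD hDS hSA, isometry_conj hD hDS hSB, isometry_conj hD hDS hSC⟩
end
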